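/- arXiv:1806.02250 — 5 statements merged into one kernel-verified Lean document; each statement's English description precedes it below -/
import Mathlib

section
/- For every ε > 0, limsup_{x→∞} (1/log x) · ∑_{p ≤ x prime, d_p < ε·log p} (log p)/p ≤ 16ε, where d_p denotes the gap from p to the next prime. -/
open scoped BigOperators

/-- The next prime after `p`: the least prime strictly greater than `p`. -/
noncomputable def nextPrime (p : ℕ) : ℕ := sInf {q : ℕ | p < q ∧ q.Prime}

/-- `d_p = p' - p`, the gap from the prime `p` to the next prime `p'`. -/
noncomputable def primeGap (p : ℕ) : ℕ := nextPrime p - p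

namespace SmallGaps

section SelbergUpperBound

open Finset BoundingSieve ArithmeticFunction
open scoped ArithmeticFunction.Moebius

/-- The sum of the Selberg terms up to level `R`. -/
noncomputable def selbergSum (s : BoundingSieve) (R : ℕ) : ℝ :=
  ∑ l ∈ s.prodPrimes.divisors with l ≤ R, s.selbergTerms l

/-- Selberg's optimal weights of level `R`. -/
noncomputable def selbergWeights (s : BoundingSieve) (R d : ℕ) : ℝ :=
  (μ d : ℝ) * (s.nu d)⁻¹ * (selbergSum s R)⁻¹ *
    ∑ l ∈ s.prodPrimes.divisors with l ≤ R, if d ∣ l then s.selbergTerms l else 0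

variable (s : BoundingSieve) {R : ℕ}

lemma selbergSum_pos (hR : 1 ≤ R) : 0 < selbergSum s R := by
  refine sum_pos (fun l hl ↦ selbergTerms_pos (Nat.dvd_of_mem_divisors (mem_filter.1 hl).1)) ?_
  exact ⟨1, by simp [hR, prodPrimes_ne_zero]⟩

lemma selbergWeights_one (hR : 1 ≤ R) : selbergWeights s R 1 = 1 := by
  have := (selbergSum_pos s hR).ne'
  simp only [selbergWeights, moebius_apply_one, Int.cast_one, s.nu_mult.map_one, inv_one, one_mul,
    isUnit_one, IsUnit.dvd, if_true]
  exact inv_mul_cancel₀ this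

lemma selbergWeights_eq_zero {d : ℕ} (hd : R < d) : selbergWeights s R d = 0 := by
  rw [selbergWeights, sum_eq_zero, mul_zero]
  intro l hl
  simp only [mem_filter, Nat.mem_divisors] at hl
  rw [if_neg]
  intro h
  have := Nat.le_of_dvd (Nat.pos_of_ne_zero (ne_zero_of_dvd_ne_zero hl.1.2 hl.1.1)) h
  lia

/-- Truncated Möbius orthogonality. -/
lemma sum_moebius_between {P l m : ℕ} (hP : Squarefree P) (hl : l ∣ P) (hm : m ∣ P) :
    ∑ d ∈ P.divisors, (if l ∣ d then if d ∣ m then (μ d : ℝ) else 0 else 0) =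
      if m = l then (μ l : ℝ) else 0 := by
  have hP0 := hP.ne_zero
  by_cases hlm : l ∣ m
  · obtain ⟨k, rfl⟩ := hlm
    have hsq := hP.squarefree_of_dvd hm
    have hl0 : 0 < l := Nat.pos_of_ne_zero (left_ne_zero_of_mul hsq.ne_zero)
    have hk0 : k ≠ 0 := right_ne_zero_of_mul hsq.ne_zero
    have hcop : l.Coprime k := Nat.coprime_of_squarefree_mul hsq
    have h1 : ∑ d ∈ P.divisors, (if l ∣ d then if d ∣ l * k then (μ d : ℝ) else 0 else 0) =
        ∑ e ∈ k.divisors, (μ l : ℝ) * μ e := by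
      simp_rw [← ite_and]
      rw [← sum_filter]
      symm
      refine sum_bij (fun e _ ↦ l * e) ?_ ?_ ?_ ?_
      · intro e he
        have he := Nat.dvd_of_mem_divisors he
        simp only [mem_filter, Nat.mem_divisors]
        exact ⟨⟨(mul_dvd_mul_left l he).trans hm, hP0⟩, Dvd.intro _ rfl, mul_dvd_mul_left l he⟩
      · intro a _ b _ h
        exact Nat.eq_of_mul_eq_mul_left hl0 h
      · intro d hd
        simp only [mem_filter, Nat.mem_divisors] at hd
        obtain ⟨-, ⟨e, rfl⟩, h⟩ := hd
        exact ⟨e, Nat.mem_divisors.2 ⟨Nat.dvd_of_mul_dvd_mul_left hl0 h, hk0⟩, rfl⟩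
      · intro e he
        rw [isMultiplicative_moebius.map_mul_of_coprime
          (hcop.coprime_dvd_right (Nat.dvd_of_mem_divisors he))]
        push_cast; rfl
    rw [h1, ← mul_sum]
    have h2 : ∑ e ∈ k.divisors, (μ e : ℝ) = if k = 1 then 1 else 0 := by
      have := congrArg (fun f : ArithmeticFunction ℤ ↦ f k) coe_zeta_mul_moebius
      simp only [coe_zeta_mul_apply, one_apply] at this
      exact_mod_cast this
    rw [h2]
    by_cases hk : k = 1
    · simp [hk]
    · rw [if_neg hk, mul_zero, if_neg]
      intro h
      exact hk (Nat.eq_of_mul_eq_mul_left hl0 (by rw [h, mul_one]))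
  · rw [if_neg (by rintro rfl; exact hlm dvd_rfl)]
    refine sum_eq_zero fun d _ ↦ ?_
    split_ifs with h1 h2
    · exact absurd (h1.trans h2) hlm
    · rfl
    · rfl

lemma sum_nu_mul_selbergWeights {l : ℕ} (hl : l ∣ s.prodPrimes) :
    ∑ d ∈ s.prodPrimes.divisors, (if l ∣ d then s.nu d * selbergWeights s R d else 0) =
      if l ≤ R then (μ l : ℝ) * s.selbergTerms l * (selbergSum s R)⁻¹ else 0 := by
  have h1 : ∀ d ∈ s.prodPrimes.divisors,
      (if l ∣ d then s.nu d * selbergWeights s R d else 0) =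
      ∑ m ∈ s.prodPrimes.divisors with m ≤ R, (selbergSum s R)⁻¹ * s.selbergTerms m *
        (if l ∣ d then if d ∣ m then (μ d : ℝ) else 0 else 0) := by
    intro d hd
    have hnu := nu_ne_zero (Nat.dvd_of_mem_divisors hd)
    split_ifs with h
    · rw [selbergWeights, mul_sum, mul_sum]
      refine sum_congr rfl fun m _ ↦ ?_
      split_ifs
      · field_simp
      · simp
    · simp
  rw [sum_congr rfl h1, sum_comm]
  simp_rw [← mul_sum]
  have h2 : ∀ m ∈ {m ∈ s.prodPrimes.divisors | m ≤ R},
      (selbergSum s R)⁻¹ * s.selbergTerms m *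
        ∑ d ∈ s.prodPrimes.divisors, (if l ∣ d then if d ∣ m then (μ d : ℝ) else 0 else 0) =
      if m = l then (μ l : ℝ) * s.selbergTerms l * (selbergSum s R)⁻¹ else 0 := by
    intro m hm
    rw [sum_moebius_between s.prodPrimes_squarefree hl
      (Nat.dvd_of_mem_divisors (mem_filter.1 hm).1)]
    split_ifs with h
    · rw [h]; ring
    · simp
  rw [sum_congr rfl h2, sum_ite_eq']
  simp only [mem_filter, Nat.mem_divisors, hl, prodPrimes_ne_zero, ne_eq, not_false_eq_true,
    true_and]

lemma mainSum_selbergWeights (hR : 1 ≤ R) :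
    s.mainSum (lambdaSquared (selbergWeights s R)) = (selbergSum s R)⁻¹ := by
  have hG := (selbergSum_pos s hR).ne'
  rw [mainSum_lambdaSquared_eq_sum_mul_sum_sq]
  have h1 : ∀ l ∈ s.prodPrimes.divisors, (s.selbergTerms l)⁻¹ *
      (∑ d ∈ s.prodPrimes.divisors, if l ∣ d then s.nu d * selbergWeights s R d else 0) ^ 2 =
      (if l ≤ R then s.selbergTerms l else 0) * (selbergSum s R)⁻¹ ^ 2 := by
    intro l hl
    have hl' := Nat.dvd_of_mem_divisors hl
    rw [sum_nu_mul_selbergWeights s hl']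
    split_ifs
    · have h2 := (selbergTerms_pos hl').ne'
      have h3 : (μ l : ℝ) ^ 2 = 1 := by
        exact_mod_cast moebius_sq_eq_one_of_squarefree (squarefree_of_dvd_prodPrimes hl')
      rw [mul_pow, mul_pow, h3]
      field_simp
    · simp
  rw [sum_congr rfl h1, ← sum_mul, ← sum_filter]
  change selbergSum s R * _ = _
  field_simp

lemma abs_selbergWeights_le_one (hR : 1 ≤ R) {d : ℕ} (hd : d ∣ s.prodPrimes) :
    |selbergWeights s R d| ≤ 1 := by
  have hG := selbergSum_pos s hR
  have hnu := nu_pos_of_dvd_prodPrimes hd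
  have hgd := selbergTerms_pos hd
  have hP0 := prodPrimes_ne_zero (s := s)
  have hd0 : 0 < d := Nat.pos_of_ne_zero (ne_zero_of_dvd_ne_zero hP0 hd)
  set T := ∑ l ∈ s.prodPrimes.divisors with l ≤ R, if d ∣ l then s.selbergTerms l else 0 with hT
  have hT' : T = ∑ l ∈ s.prodPrimes.divisors with l ≤ R ∧ d ∣ l, s.selbergTerms l := by
    rw [hT, ← sum_filter, filter_filter]
  have hT0 : 0 ≤ T := by
    rw [hT']
    exact sum_nonneg fun l hl ↦
      (selbergTerms_pos (Nat.dvd_of_mem_divisors (mem_filter.1 hl).1)).le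
  have hmul : ∀ l, l ∣ s.prodPrimes → d ∣ l → d.Coprime (l / d) := by
    intro l hl hdl
    apply Nat.coprime_of_squarefree_mul
    rw [Nat.mul_div_cancel' hdl]
    exact squarefree_of_dvd_prodPrimes hl
  have key : (s.nu d)⁻¹ * T ≤ selbergSum s R := by
    have h1 : (s.nu d)⁻¹ = (s.selbergTerms d)⁻¹ * ∑ k ∈ d.divisors, s.selbergTerms k := by
      have := sum_divisors_selbergTerms_eq_selbergTerms_mul_nu_inv hd
      rw [← sum_filter, Nat.divisors_filter_dvd_of_dvd hP0 hd] at this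
      rw [this]
      field_simp
    have h2 : (s.nu d)⁻¹ * T = ∑ x ∈ d.divisors ×ˢ
        {l ∈ s.prodPrimes.divisors | l ≤ R ∧ d ∣ l}, s.selbergTerms (x.1 * (x.2 / d)) := by
      rw [h1, hT', mul_assoc, sum_mul_sum, ← sum_product', mul_sum]
      refine sum_congr rfl fun x hx ↦ ?_
      simp only [mem_product, mem_filter, Nat.mem_divisors] at hx
      obtain ⟨⟨hk, -⟩, ⟨hl, -⟩, -, hdl⟩ := hx
      have hc := hmul _ hl hdl
      have h3 : s.selbergTerms x.2 = s.selbergTerms d * s.selbergTerms (x.2 / d) := by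
        rw [← selbergTerms_isMultiplicative.map_mul_of_coprime hc, Nat.mul_div_cancel' hdl]
      rw [selbergTerms_isMultiplicative.map_mul_of_coprime (hc.coprime_dvd_left hk), h3]
      field_simp
    rw [h2, ← sum_image (f := s.selbergTerms) (g := fun x : ℕ × ℕ ↦ x.1 * (x.2 / d))]
    · refine sum_le_sum_of_subset_of_nonneg ?_ fun l hl _ ↦
        (selbergTerms_pos (Nat.dvd_of_mem_divisors (mem_filter.1 hl).1)).le
      intro n hn
      obtain ⟨x, hx, rfl⟩ := mem_image.1 hn
      simp only [mem_product, mem_filter, Nat.mem_divisors] at hx ⊢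
      obtain ⟨⟨hk, -⟩, ⟨hl, -⟩, hlR, hdl⟩ := hx
      have h4 : x.1 * (x.2 / d) ∣ x.2 := by
        conv_rhs => rw [← Nat.mul_div_cancel' hdl]
        exact mul_dvd_mul_right hk _
      have hx0 : 0 < x.2 := Nat.pos_of_ne_zero (ne_zero_of_dvd_ne_zero hP0 hl)
      exact ⟨⟨h4.trans hl, hP0⟩, (Nat.le_of_dvd hx0 h4).trans hlR⟩
    · intro x hx y hy hxy
      simp only [coe_product, coe_filter, Set.mem_prod, mem_coe, Nat.mem_divisors,
        Set.mem_ofPred_eq] at hx hy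
      obtain ⟨⟨hk, -⟩, ⟨hl, -⟩, -, hdl⟩ := hx
      obtain ⟨⟨hk', -⟩, ⟨hl', -⟩, -, hdl'⟩ := hy
      have e1 : Nat.gcd d (x.1 * (x.2 / d)) = x.1 := by
        rw [Nat.Coprime.gcd_mul_right_cancel_right _ (hmul _ hl hdl).symm, Nat.gcd_eq_right hk]
      have e2 : Nat.gcd d (y.1 * (y.2 / d)) = y.1 := by
        rw [Nat.Coprime.gcd_mul_right_cancel_right _ (hmul _ hl' hdl').symm, Nat.gcd_eq_right hk']
      have hxy : x.1 * (x.2 / d) = y.1 * (y.2 / d) := hxy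
      have h5 : x.1 = y.1 := by rw [← e1, ← e2, hxy]
      have hx1 : 0 < x.1 := Nat.pos_of_dvd_of_pos hk hd0
      rw [h5] at hxy
      have h6 := Nat.eq_of_mul_eq_mul_left (h5 ▸ hx1) hxy
      refine Prod.ext h5 ?_
      rw [← Nat.mul_div_cancel' hdl, ← Nat.mul_div_cancel' hdl', h6]
  have hmu : |(μ d : ℝ)| ≤ 1 := by exact_mod_cast abs_moebius_le_one
  rw [selbergWeights, ← hT, show (μ d : ℝ) * (s.nu d)⁻¹ * (selbergSum s R)⁻¹ * T =
    μ d * (((s.nu d)⁻¹ * T) / selbergSum s R) by ring, abs_mul]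
  refine mul_le_one₀ hmu (abs_nonneg _) ?_
  rw [abs_of_nonneg (by positivity)]
  exact (div_le_one hG).2 key

lemma errSum_selbergWeights_le (hR : 1 ≤ R) :
    s.errSum (lambdaSquared (selbergWeights s R)) ≤
      ∑ d ∈ s.prodPrimes.divisors with d ≤ R, ∑ e ∈ s.prodPrimes.divisors with e ≤ R,
        |s.rem (d.lcm e)| := by
  have hP0 := prodPrimes_ne_zero (s := s)
  have hw : ∀ d, d ∣ s.prodPrimes → |selbergWeights s R d| ≤ if d ≤ R then 1 else 0 := by
    intro d hd
    split_ifs with h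
    · exact abs_selbergWeights_le_one s hR hd
    · rw [selbergWeights_eq_zero s (not_le.1 h), abs_zero]
  calc s.errSum (lambdaSquared (selbergWeights s R))
      ≤ ∑ m ∈ s.prodPrimes.divisors, ∑ d ∈ s.prodPrimes.divisors, ∑ e ∈ s.prodPrimes.divisors,
        if m = d.lcm e then (if d ≤ R then if e ≤ R then |s.rem (d.lcm e)| else 0 else 0)
          else 0 := by
        refine sum_le_sum fun m hm ↦ ?_
        have hmP := Nat.dvd_of_mem_divisors hm
        have hsub : m.divisors ⊆ s.prodPrimes.divisors := Nat.divisors_subset_of_dvd hP0 hmP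
        have hnn : ∀ d e : ℕ, (0 : ℝ) ≤ if m = d.lcm e then
            (if d ≤ R then if e ≤ R then |s.rem (d.lcm e)| else 0 else 0) else 0 := by
          intro d e
          split_ifs <;> positivity
        calc |lambdaSquared (selbergWeights s R) m| * |s.rem m|
            ≤ (∑ d ∈ m.divisors, ∑ e ∈ m.divisors, |if m = d.lcm e then
                selbergWeights s R d * selbergWeights s R e else 0|) * |s.rem m| := by
              gcongr
              refine (abs_sum_le_sum_abs _ _).trans (sum_le_sum fun d _ ↦ abs_sum_le_sum_abs _ _)
          _ = ∑ d ∈ m.divisors, ∑ e ∈ m.divisors, |if m = d.lcm e then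
                selbergWeights s R d * selbergWeights s R e else 0| * |s.rem m| := by
              simp_rw [sum_mul]
          _ ≤ ∑ d ∈ m.divisors, ∑ e ∈ m.divisors, if m = d.lcm e then
                (if d ≤ R then if e ≤ R then |s.rem (d.lcm e)| else 0 else 0) else 0 := by
              refine sum_le_sum fun d hd ↦ sum_le_sum fun e he ↦ ?_
              have h1 := hw d ((Nat.dvd_of_mem_divisors hd).trans hmP)
              have h2 := hw e ((Nat.dvd_of_mem_divisors he).trans hmP)
              by_cases hm : m = d.lcm e
              · rw [if_pos hm, if_pos hm, ← hm, abs_mul]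
                have h3 := mul_le_mul h1 h2 (abs_nonneg _) (by split_ifs <;> norm_num)
                refine (mul_le_mul_of_nonneg_right h3 (abs_nonneg _)).trans_eq ?_
                split_ifs <;> simp
              · simp [hm]
          _ ≤ _ := by
              refine (sum_le_sum_of_subset_of_nonneg hsub
                fun d _ _ ↦ sum_nonneg fun e _ ↦ hnn d e).trans ?_
              exact sum_le_sum fun d _ ↦ sum_le_sum_of_subset_of_nonneg hsub fun e _ _ ↦ hnn d e
    _ = _ := by
        rw [sum_comm, sum_filter]
        refine sum_congr rfl fun d hd ↦ ?_
        rw [sum_comm]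
        split_ifs with hdR
        · rw [sum_filter]
          refine sum_congr rfl fun e he ↦ ?_
          rw [sum_ite_eq_of_mem']
          exact Nat.mem_divisors.2 ⟨Nat.lcm_dvd (Nat.dvd_of_mem_divisors hd)
            (Nat.dvd_of_mem_divisors he), hP0⟩
        · simp

/-- Selberg's upper bound sieve. -/
theorem siftedSum_le_selberg (hR : 1 ≤ R) :
    s.siftedSum ≤ s.totalMass / selbergSum s R +
      ∑ d ∈ s.prodPrimes.divisors with d ≤ R, ∑ e ∈ s.prodPrimes.divisors with e ≤ R,
        |s.rem (d.lcm e)| := by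
  refine (siftedSum_le_mainSum_errSum_of_upperMoebius _
    (upperMoebius_lambdaSquared _ (selbergWeights_one s hR))).trans ?_
  rw [mainSum_selbergWeights s hR, ← div_eq_mul_inv]
  gcongr
  exact errSum_selbergWeights_le s hR

end SelbergUpperBound

section DivisorSums

open Finset

/-- The partial sum of `τ(n)/n` over those `n ≤ y` all of whose prime factors lie in `S`. -/
noncomputable def divisorSum (S : Finset ℕ) (y : ℕ) : ℝ :=
  ∑ n ∈ Icc 1 y with n.primeFactors ⊆ S, (n.divisors.card : ℝ) / n

lemma divisorSum_nonneg (S : Finset ℕ) (y : ℕ) : 0 ≤ divisorSum S y :=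
  sum_nonneg fun _ _ ↦ by positivity

lemma divisorSum_mono (S : Finset ℕ) {y z : ℕ} (h : y ≤ z) : divisorSum S y ≤ divisorSum S z := by
  refine sum_le_sum_of_subset_of_nonneg ?_ fun _ _ _ ↦ by positivity
  exact filter_subset_filter _ (Icc_subset_Icc_right h)

/-- The part of `divisorSum (insert p S)` carried by exact power `p ^ k`. -/
lemma sum_factorization_eq {S : Finset ℕ} {p : ℕ} (hp : p.Prime) (hpS : p ∉ S) (y k : ℕ) :
    ∑ n ∈ Icc 1 y with n.primeFactors ⊆ insert p S ∧ n.factorization p = k,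
      (n.divisors.card : ℝ) / n = ((k + 1 : ℝ) / p ^ k) * divisorSum S (y / p ^ k) := by
  have hpk : 0 < p ^ k := pow_pos hp.pos k
  rw [divisorSum, mul_sum]
  symm
  refine sum_bij (fun m _ ↦ p ^ k * m) ?_ ?_ ?_ ?_
  · intro m hm
    simp only [mem_filter, mem_Icc] at hm ⊢
    obtain ⟨⟨h1, h2⟩, h3⟩ := hm
    have hpm : ¬ p ∣ m := fun h ↦ hpS (h3 (Nat.mem_primeFactors.2 ⟨hp, h, by lia⟩))
    refine ⟨⟨Nat.mul_pos hpk h1, ?_⟩, ?_, ?_⟩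
    · rw [mul_comm]; exact (Nat.le_div_iff_mul_le hpk).1 h2
    · rw [Nat.primeFactors_mul hpk.ne' (by lia)]
      refine union_subset ?_ (h3.trans (subset_insert _ _))
      intro q hq
      rw [(Nat.prime_dvd_prime_iff_eq (Nat.prime_of_mem_primeFactors hq) hp).1
        ((Nat.prime_of_mem_primeFactors hq).dvd_of_dvd_pow (Nat.dvd_of_mem_primeFactors hq))]
      exact mem_insert_self _ _
    · rw [Nat.factorization_mul hpk.ne' (by lia), Finsupp.add_apply,
        Nat.factorization_pow_self hp, Nat.factorization_eq_zero_of_not_dvd hpm, add_zero]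
  · intro a _ b _ h
    exact Nat.eq_of_mul_eq_mul_left hpk h
  · intro n hn
    simp only [mem_filter, mem_Icc] at hn
    obtain ⟨⟨h1, h2⟩, h3, h4⟩ := hn
    have hn0 : n ≠ 0 := by lia
    have hd : p ^ k ∣ n := h4 ▸ Nat.ordProj_dvd n p
    obtain ⟨m, rfl⟩ := hd
    have hm0 : m ≠ 0 := by rintro rfl; simp at hn0
    refine ⟨m, ?_, rfl⟩
    simp only [mem_filter, mem_Icc]
    refine ⟨⟨by lia, (Nat.le_div_iff_mul_le hpk).2 (by rwa [mul_comm])⟩, ?_⟩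
    intro q hq
    have hq' := h3 (Nat.primeFactors_mono (Dvd.intro_left _ rfl) hn0 hq)
    refine (mem_insert.1 hq').resolve_left ?_
    rintro rfl
    rw [Nat.factorization_mul hpk.ne' hm0, Finsupp.add_apply, Nat.factorization_pow_self hp] at h4
    have := hp.factorization_pos_of_dvd hm0 (Nat.dvd_of_mem_primeFactors hq)
    lia
  · intro m hm
    simp only [mem_filter, mem_Icc] at hm
    obtain ⟨⟨h1, h2⟩, h3⟩ := hm
    have hpm : ¬ p ∣ m := fun h ↦ hpS (h3 (Nat.mem_primeFactors.2 ⟨hp, h, by lia⟩))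
    have hc : (p ^ k).Coprime m := Nat.Coprime.pow_left k ((hp.coprime_iff_not_dvd).2 hpm)
    rw [hc.card_divisors_mul, Nat.divisors_prime_pow hp, card_map, card_range]
    have : (m : ℝ) ≠ 0 := by positivity
    have : (p : ℝ) ≠ 0 := by exact_mod_cast hp.ne_zero
    push_cast
    field_simp

lemma sum_succ_mul_inv_pow_le {x : ℝ} (hx : 1 < x) (K : ℕ) :
    ∑ k ∈ range K, ((k + 1 : ℕ) + 1 : ℝ) / x ^ (k + 1) ≤ (2 * x - 1) / (x - 1) ^ 2 := by
  have hx1 : 0 < x - 1 := by linarith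
  have key : ∑ k ∈ range K, ((k + 1 : ℕ) + 1 : ℝ) / x ^ (k + 1) =
      (2 * x - 1) / (x - 1) ^ 2 - ((K + 2) * x - (K + 1)) / ((x - 1) ^ 2 * x ^ K) := by
    induction K with
    | zero => simp
    | succ K ih =>
      rw [sum_range_succ, ih]
      have : x ≠ 0 := by positivity
      push_cast
      field_simp
      ring
  rw [key]
  have : 0 ≤ ((K + 2) * x - (K + 1)) / ((x - 1) ^ 2 * x ^ K) := by
    apply div_nonneg _ (by positivity)
    have : (0 : ℝ) ≤ K := by positivity
    nlinarith
  linarith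

lemma divisorSum_insert_le {S : Finset ℕ} {p : ℕ} (hp : p.Prime) (hpS : p ∉ S) (y : ℕ) :
    divisorSum (insert p S) y ≤ divisorSum S y +
      (2 * p - 1 : ℝ) / (p - 1) ^ 2 * divisorSum S (y / p) := by
  have h1 : divisorSum (insert p S) y =
      ∑ k ∈ range (y + 1), ((k + 1 : ℝ) / p ^ k) * divisorSum S (y / p ^ k) := by
    rw [divisorSum, ← sum_fiberwise_of_maps_to (t := range (y + 1))
      (g := fun n ↦ n.factorization p)]
    · refine sum_congr rfl fun k _ ↦ ?_
      rw [← sum_factorization_eq hp hpS, filter_filter]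
    · intro n hn
      simp only [mem_filter, mem_Icc] at hn
      have := Nat.factorization_lt (n := n) p (by lia)
      simp; lia
  have hp1 : (1 : ℝ) < p := by exact_mod_cast hp.one_lt
  rw [h1, sum_range_succ']
  simp only [pow_zero, Nat.div_one, CharP.cast_eq_zero, zero_add, div_one, one_mul]
  rw [add_comm]
  gcongr
  calc _ ≤ ∑ k ∈ range y, (((k + 1 : ℕ) + 1 : ℝ) / p ^ (k + 1)) * divisorSum S (y / p) := by
        gcongr with k
        refine divisorSum_mono S (Nat.div_le_div_left ?_ hp.pos)
        exact Nat.le_self_pow (by lia) p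
    _ ≤ _ := by
        rw [← sum_mul]
        gcongr
        · exact divisorSum_nonneg _ _
        · exact sum_succ_mul_inv_pow_le hp1 y

lemma sum_divisors_prime_mul {g : ℕ → ℝ} (hg : ∀ m n, m.Coprime n → g (m * n) = g m * g n)
    {p Q : ℕ} (hp : p.Prime) (hQ : Q ≠ 0) (hpQ : ¬ p ∣ Q) (y : ℕ) :
    ∑ l ∈ (p * Q).divisors with l ≤ y, g l =
      ∑ l ∈ Q.divisors with l ≤ y, g l + g p * ∑ l ∈ Q.divisors with l ≤ y / p, g l := by
  have hdiv : (p * Q).divisors = Q.divisors ∪ Q.divisors.image (p * ·) := by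
    ext d
    simp only [Nat.mem_divisors, mem_union, mem_image, ne_eq]
    constructor
    · rintro ⟨h, h0⟩
      by_cases hpd : p ∣ d
      · obtain ⟨e, rfl⟩ := hpd
        exact Or.inr ⟨e, ⟨Nat.dvd_of_mul_dvd_mul_left hp.pos h, hQ⟩, rfl⟩
      · exact Or.inl ⟨((hp.coprime_iff_not_dvd.2 hpd).symm).dvd_of_dvd_mul_left h, hQ⟩
    · rintro (⟨h, -⟩ | ⟨e, ⟨h, -⟩, rfl⟩)
      · exact ⟨h.mul_left p, mul_ne_zero hp.ne_zero hQ⟩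
      · exact ⟨mul_dvd_mul_left p h, mul_ne_zero hp.ne_zero hQ⟩
  have hdisj : Disjoint Q.divisors (Q.divisors.image (p * ·)) := by
    rw [Finset.disjoint_left]
    intro d hd hd'
    obtain ⟨e, -, rfl⟩ := mem_image.1 hd'
    exact hpQ ((Dvd.intro e rfl).trans (Nat.dvd_of_mem_divisors hd))
  rw [hdiv, filter_union, sum_union (disjoint_filter_filter hdisj), mul_sum]
  congr 1
  rw [sum_filter, sum_image (fun a _ b _ h ↦ Nat.eq_of_mul_eq_mul_left hp.pos h), ← sum_filter]
  have : {a ∈ Q.divisors | p * a ≤ y} = {a ∈ Q.divisors | a ≤ y / p} := by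
    refine filter_congr fun a _ ↦ ?_
    rw [Nat.le_div_iff_mul_le hp.pos, mul_comm]
  rw [this]
  refine sum_congr rfl fun a ha ↦ hg _ _ (hp.coprime_iff_not_dvd.2 fun h ↦ hpQ ?_)
  exact h.trans (Nat.dvd_of_mem_divisors (mem_filter.1 ha).1)

/-- Lower bound for truncated sums of a multiplicative function `g` of sieve dimension two,
`c` being the correction at the primes where `g` only has dimension one. -/
lemma divisorSum_le_prod_mul_sum {g c : ℕ → ℝ} (hg1 : g 1 = 1)
    (hg : ∀ m n, m.Coprime n → g (m * n) = g m * g n) (S : Finset ℕ)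
    (hS : ∀ p ∈ S, p.Prime ∧ ((c p = p / (p - 1) ∧ 1 / (p - 1 : ℝ) ≤ g p) ∨
      (c p = 1 ∧ (2 * p - 1 : ℝ) / (p - 1) ^ 2 ≤ g p))) (y : ℕ) :
    divisorSum S y ≤ (∏ p ∈ S, c p) * ∑ l ∈ (∏ p ∈ S, p).divisors with l ≤ y, g l := by
  induction S using Finset.induction_on generalizing y with
  | empty =>
    rcases Nat.eq_zero_or_pos y with rfl | hy
    · simp [divisorSum, filter_singleton]
    · have : {n ∈ Icc 1 y | n.primeFactors ⊆ ∅} = {1} := by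
        ext n
        simp only [mem_filter, mem_Icc, subset_empty, Nat.primeFactors_eq_empty, mem_singleton]
        lia
      rw [divisorSum, this, prod_empty, prod_empty, Nat.divisors_one, filter_singleton]
      simp [hg1, Nat.succ_le_iff.2 hy]
  | insert p S hpS ih =>
    obtain ⟨hp, hcg⟩ := hS p (mem_insert_self _ _)
    have ih := ih fun q hq ↦ hS q (mem_insert_of_mem hq)
    have hQ : ∏ q ∈ S, q ≠ 0 :=
      prod_ne_zero_iff.2 fun q hq ↦ (hS q (mem_insert_of_mem hq)).1.ne_zero
    have hpQ : ¬ p ∣ ∏ q ∈ S, q := by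
      intro h
      obtain ⟨q, hq, hpq⟩ := (Prime.dvd_finsetProd_iff hp.prime _).1 h
      exact hpS ((Nat.prime_dvd_prime_iff_eq hp (hS q (mem_insert_of_mem hq)).1).1 hpq ▸ hq)
    rw [prod_insert hpS, prod_insert hpS, sum_divisors_prime_mul hg hp hQ hpQ]
    refine (divisorSum_insert_le hp hpS y).trans ?_
    have hp1 : (1 : ℝ) < p := by exact_mod_cast hp.one_lt
    have hp1' : (0 : ℝ) < p - 1 := by linarith
    have i1 := ih y
    have i2 := ih (y / p)
    have hm := divisorSum_mono S (Nat.div_le_self y p)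
    have h0 := divisorSum_nonneg S (y / p)
    set C := ∏ q ∈ S, c q
    set A := ∑ l ∈ (∏ q ∈ S, q).divisors with l ≤ y, g l
    set A' := ∑ l ∈ (∏ q ∈ S, q).divisors with l ≤ y / p, g l
    set B := divisorSum S y
    set B' := divisorSum S (y / p)
    rcases hcg with ⟨h1, h2⟩ | ⟨h1, h2⟩
    · have hgp : 0 ≤ g p := le_trans (by positivity) h2
      have h3 : 1 / (p - 1 : ℝ) * B' ≤ g p * (C * A') :=
        mul_le_mul h2 i2 h0 hgp
      rw [h1]
      calc B + (2 * p - 1) / (p - 1) ^ 2 * B'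
          = p / (p - 1) * (B + 1 / (p - 1 : ℝ) * B') - (B - B') / (p - 1) := by
            field_simp; ring
        _ ≤ p / (p - 1) * (B + 1 / (p - 1 : ℝ) * B') := by
            have : 0 ≤ (B - B') / (p - 1 : ℝ) := div_nonneg (by linarith) hp1'.le
            linarith
        _ ≤ p / (p - 1) * (C * A + g p * (C * A')) := by gcongr
        _ = _ := by ring
    · have hu : (0 : ℝ) ≤ (2 * p - 1) / (p - 1) ^ 2 := by
        apply div_nonneg _ (by positivity); linarith
      have h3 := mul_le_mul h2 i2 h0 (hu.trans h2)
      rw [h1]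
      linarith

lemma sq_log_le_divisorSum {R : ℕ} (hR : 1 ≤ R) {S : Finset ℕ}
    (hS : ∀ n ∈ Icc 1 R, n.primeFactors ⊆ S) :
    Real.log R ^ 2 / 2 ≤ divisorSum S R := by
  have h1 : divisorSum S R = ∑ a ∈ Icc 1 R, (a : ℝ)⁻¹ * ∑ b ∈ Icc 1 (R / a), (b : ℝ)⁻¹ := by
    rw [divisorSum, filter_true_of_mem hS]
    have : ∀ n ∈ Icc 1 R, (n.divisors.card : ℝ) / n =
        ∑ a ∈ Icc 1 R, if a ∣ n then (n : ℝ)⁻¹ else 0 := by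
      intro n hn
      rw [mem_Icc] at hn
      rw [← sum_filter]
      have : {a ∈ Icc 1 R | a ∣ n} = n.divisors := by
        ext a
        simp only [mem_filter, mem_Icc, Nat.mem_divisors]
        constructor
        · rintro ⟨-, h⟩; exact ⟨h, by lia⟩
        · rintro ⟨h, -⟩
          exact ⟨⟨Nat.pos_of_dvd_of_pos h (by lia), (Nat.le_of_dvd (by lia) h).trans hn.2⟩, h⟩
      rw [this, sum_const, nsmul_eq_mul, div_eq_mul_inv]
    rw [sum_congr rfl this, sum_comm]
    refine sum_congr rfl fun a ha ↦ ?_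
    rw [mem_Icc] at ha
    rw [← sum_filter, mul_sum]
    symm
    refine sum_bij (fun b _ ↦ a * b) ?_ ?_ ?_ ?_
    · intro b hb
      simp only [mem_Icc, mem_filter] at hb ⊢
      refine ⟨⟨Nat.mul_pos ha.1 hb.1, ?_⟩, Dvd.intro _ rfl⟩
      rw [mul_comm]; exact (Nat.le_div_iff_mul_le ha.1).1 hb.2
    · intro b _ b' _ h
      exact Nat.eq_of_mul_eq_mul_left ha.1 h
    · intro n hn
      simp only [mem_Icc, mem_filter] at hn
      obtain ⟨⟨h1, h2⟩, b, rfl⟩ := hn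
      refine ⟨b, ?_, rfl⟩
      rw [mem_Icc]
      refine ⟨Nat.pos_of_mul_pos_left h1, (Nat.le_div_iff_mul_le ha.1).2 (by rwa [mul_comm])⟩
    · intro b _
      push_cast
      rw [mul_inv]
  have h2 : ∀ a ∈ Ico 1 R, (Real.log (R / a) ^ 2 - Real.log (R / (a + 1 : ℕ)) ^ 2) / 2 ≤
      (a : ℝ)⁻¹ * ∑ b ∈ Icc 1 (R / a), (b : ℝ)⁻¹ := by
    intro a ha
    rw [mem_Ico] at ha
    have ha0 : (0 : ℝ) < a := by exact_mod_cast ha.1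
    have hR0 : (0 : ℝ) < R := by exact_mod_cast hR
    have hH : Real.log (R / a) ≤ ∑ b ∈ Icc 1 (R / a), (b : ℝ)⁻¹ := by
      have := log_le_harmonic_floor ((R : ℝ) / a) (by positivity)
      rw [Nat.floor_div_eq_div, harmonic_eq_sum_Icc] at this
      push_cast at this
      exact this
    have hL : 0 ≤ Real.log (R / a) :=
      Real.log_nonneg ((one_le_div ha0).2 (by exact_mod_cast ha.2.le))
    have hd : Real.log (R / a) - Real.log (R / (a + 1 : ℕ)) ≤ (a : ℝ)⁻¹ := by
      rw [Real.log_div hR0.ne' ha0.ne', Real.log_div hR0.ne' (by positivity)]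
      have h := Real.log_le_sub_one_of_pos (x := ((a + 1 : ℕ) : ℝ) / a) (by positivity)
      rw [Real.log_div (by positivity) ha0.ne'] at h
      have : ((a + 1 : ℕ) : ℝ) / a - 1 = (a : ℝ)⁻¹ := by push_cast; field_simp; ring
      linarith
    have h3 : (a : ℝ)⁻¹ * Real.log (R / a) ≤ (a : ℝ)⁻¹ * ∑ b ∈ Icc 1 (R / a), (b : ℝ)⁻¹ := by
      gcongr
    nlinarith [sq_nonneg (Real.log (R / a) - Real.log (R / (a + 1 : ℕ)))]
  have h3 : ∀ M : ℕ, 1 ≤ M → ∑ a ∈ Ico 1 M,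
      (Real.log (R / a) ^ 2 - Real.log (R / (a + 1 : ℕ)) ^ 2) / 2 =
      (Real.log R ^ 2 - Real.log (R / M) ^ 2) / 2 := by
    intro M hM
    induction M, hM using Nat.le_induction with
    | base => simp
    | succ M hM ih => rw [sum_Ico_succ_top hM, ih]; ring
  have hR0 : (R : ℝ) ≠ 0 := by positivity
  calc Real.log R ^ 2 / 2 = (Real.log R ^ 2 - Real.log (R / R) ^ 2) / 2 := by simp [hR0]
    _ = _ := (h3 R hR).symm
    _ ≤ _ := sum_le_sum h2
    _ ≤ _ := by
      rw [h1]
      refine sum_le_sum_of_subset_of_nonneg Ico_subset_Icc_self fun _ _ _ ↦ ?_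
      exact mul_nonneg (by positivity) (sum_nonneg fun _ _ ↦ by positivity)

end DivisorSums

section PrimePairs

open Finset BoundingSieve ArithmeticFunction

/-- The number of solutions of `a (a + h) = 0` modulo `d`. -/
noncomputable def rootCount (h d : ℕ) : ℕ := Set.ncard {a : ZMod d | a * (a + h) = 0}

lemma rootCount_one (h : ℕ) : rootCount h 1 = 1 := by
  rw [rootCount, show {a : ZMod 1 | a * (a + h) = 0} = {0} from
    Set.ext fun a ↦ ⟨fun _ ↦ Subsingleton.elim _ _, fun _ ↦ Subsingleton.elim _ _⟩]
  exact Set.ncard_singleton 0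

lemma rootCount_mul (h : ℕ) {m n : ℕ} (hmn : m.Coprime n) :
    rootCount h (m * n) = rootCount h m * rootCount h n := by
  let e := ZMod.chineseRemainder hmn
  have : e.toEquiv '' {a : ZMod (m * n) | a * (a + h) = 0} =
      {a : ZMod m | a * (a + h) = 0} ×ˢ {a : ZMod n | a * (a + h) = 0} := by
    rw [Equiv.image_eq_preimage_symm]
    ext x
    have hx : e.symm x * (e.symm x + h) = 0 ↔ x * (x + h) = 0 := by
      rw [← e.map_eq_zero_iff]
      simp
    change e.symm x * (e.symm x + h) = 0 ↔ _
    rw [hx, Prod.ext_iff]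
    rfl
  rw [rootCount, ← Set.ncard_image_of_injective _ e.toEquiv.injective, this, Set.ncard_prod]
  rfl

lemma rootCount_prime (h : ℕ) {p : ℕ} (hp : p.Prime) :
    rootCount h p = if p ∣ h then 1 else 2 := by
  have := Fact.mk hp
  have h1 : {a : ZMod p | a * (a + h) = 0} = {0, -(h : ZMod p)} := by
    ext a
    simp [add_eq_zero_iff_eq_neg]
  rw [rootCount, h1]
  split_ifs with hd
  · rw [(ZMod.natCast_eq_zero_iff h p).2 hd]; simp
  · refine Set.ncard_pair fun h0 ↦ hd ?_
    rw [← ZMod.natCast_eq_zero_iff]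
    simpa using h0.symm

/-- The density of the `n` with `d ∣ n (n + h)`. -/
noncomputable def rootDensity (h : ℕ) : ArithmeticFunction ℝ where
  toFun d := rootCount h d / d
  map_zero' := by simp

lemma rootDensity_apply (h d : ℕ) : rootDensity h d = rootCount h d / d := rfl

lemma rootDensity_isMultiplicative (h : ℕ) : (rootDensity h).IsMultiplicative := by
  refine ⟨by simp [rootDensity_apply, rootCount_one], fun {m n} hmn ↦ ?_⟩
  rw [rootDensity_apply, rootCount_mul h hmn]
  push_cast
  rw [rootDensity_apply, rootDensity_apply, div_mul_div_comm]

lemma rootCount_le_two_pow (h : ℕ) {d : ℕ} (hd : Squarefree d) :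
    rootCount h d ≤ 2 ^ d.primeFactors.card := by
  induction d using Nat.recOnPosPrimePosCoprime with
  | zero => exact absurd hd not_squarefree_zero
  | one => simp [rootCount_one]
  | prime_pow p n hp hn =>
    have hn1 : n = 1 := by
      by_contra hne
      exact (Nat.squarefree_pow_iff hp.ne_one hn.ne').1 hd |>.2 |> hne
    rw [hn1, pow_one, rootCount_prime h hp, hp.primeFactors]
    split_ifs <;> simp
  | coprime a b ha hb hab iha ihb =>
    rw [rootCount_mul h hab, hab.primeFactors_mul, card_union_of_disjoint hab.disjoint_primeFactors,
      pow_add]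
    rw [Nat.squarefree_mul hab] at hd
    exact Nat.mul_le_mul (iha hd.1) (ihb hd.2)

lemma abs_card_sub_rootDensity_le (h X : ℕ) {d : ℕ} (hd : 0 < d) :
    |(((range X).filter fun n ↦ d ∣ n * (n + h)).card : ℝ) - rootDensity h d * X| ≤
      rootCount h d := by
  have : NeZero d := ⟨hd.ne'⟩
  classical
  set T : Finset (ZMod d) := univ.filter fun a ↦ a * (a + h) = 0 with hT
  have hTc : rootCount h d = T.card := by
    rw [rootCount, ← Set.ncard_coe_finset]
    congr 1
    ext a
    simp [hT]
  have h1 : ((range X).filter fun n ↦ d ∣ n * (n + h)).card =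
      ∑ a ∈ T, ((range X).filter fun n ↦ n ≡ a.val [MOD d]).card := by
    rw [card_eq_sum_card_fiberwise (f := fun n : ℕ ↦ (n : ZMod d)) (t := T)]
    · refine sum_congr rfl fun a ha ↦ ?_
      congr 1
      ext n
      have hiff : n ≡ a.val [MOD d] ↔ (n : ZMod d) = a := by
        rw [← ZMod.natCast_eq_natCast_iff, ZMod.natCast_zmod_val]
      simp only [mem_filter, hiff, and_congr_left_iff, and_iff_left_iff_imp]
      rintro rfl _
      rw [← ZMod.natCast_eq_zero_iff]
      push_cast
      exact (mem_filter.1 ha).2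
    · intro n hn
      have hn := (mem_filter.1 (mem_coe.1 hn)).2
      rw [← ZMod.natCast_eq_zero_iff] at hn
      push_cast at hn
      simpa [hT] using hn
  have h2 : ∀ a ∈ T, |(((range X).filter fun n ↦ n ≡ a.val [MOD d]).card : ℝ) - X / d| ≤ 1 := by
    intro a _
    rw [← Nat.count_eq_card_filter_range, Nat.count_modEq_card _ hd]
    have hd' : (0 : ℝ) < d := by exact_mod_cast hd
    have e1 : (d : ℝ) * (X / d : ℕ) + (X % d : ℕ) = X := by exact_mod_cast Nat.div_add_mod X d
    have e2 : ((X % d : ℕ) : ℝ) < d := by exact_mod_cast Nat.mod_lt X hd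
    have e3 : (0 : ℝ) ≤ (X % d : ℕ) := by positivity
    have e4 : (X : ℝ) / d = (X / d : ℕ) + (X % d : ℕ) / d := by
      field_simp; linarith
    have e5 : ((X % d : ℕ) : ℝ) / d < 1 := (div_lt_one hd').2 e2
    have e6 : 0 ≤ ((X % d : ℕ) : ℝ) / d := by positivity
    rw [e4, abs_le]
    push_cast
    split_ifs <;> constructor <;> simp <;> linarith
  rw [h1, rootDensity_apply, hTc]
  push_cast
  rw [show (T.card : ℝ) / d * X = ∑ a ∈ T, (X / d : ℝ) by rw [sum_const, nsmul_eq_mul]; ring,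
    ← sum_sub_distrib]
  refine (abs_sum_le_sum_abs _ _).trans ((sum_le_sum h2).trans ?_)
  simp

/-- The sieve problem of removing from `n (n + h)`, `n < X`, the multiples of primes up to `R`. -/
noncomputable def pairSieve (h : ℕ) (hh : 2 ∣ h) (X R : ℕ) : BoundingSieve where
  support := (range X).image fun n ↦ n * (n + h)
  prodPrimes := primorial R
  prodPrimes_squarefree := squarefree_primorial R
  weights _ := 1
  weights_nonneg _ := zero_le_one
  totalMass := X
  nu := rootDensity h
  nu_mult := rootDensity_isMultiplicative h
  nu_pos_of_prime p hp _ := by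
    have := hp.pos
    rw [rootDensity_apply, rootCount_prime h hp]
    split_ifs <;> positivity
  nu_lt_one_of_prime p hp _ := by
    have h2 := hp.two_le
    have hp0 : (0 : ℝ) < p := by exact_mod_cast hp.pos
    rw [rootDensity_apply, rootCount_prime h hp, div_lt_one hp0]
    split_ifs with hd
    · exact_mod_cast hp.one_lt
    · have : p ≠ 2 := by rintro rfl; exact hd hh
      exact_mod_cast lt_of_le_of_ne h2 this.symm

lemma injective_mul_add (h : ℕ) : Function.Injective fun n : ℕ ↦ n * (n + h) := by
  intro a b hab
  simp only at hab
  rcases lt_trichotomy a b with hlt | rfl | hlt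
  · nlinarith
  · rfl
  · nlinarith

lemma sum_card_divisors_le {R : ℕ} (hR : 1 ≤ R) :
    ∑ n ∈ Ioc 0 R, (n.divisors.card : ℝ) ≤ R * (1 + Real.log R) := by
  have h1 := sum_Ioc_sigma0_eq_sum_div R
  simp only [sigma_zero_apply] at h1
  have h2 : ∑ n ∈ Ioc 0 R, (n.divisors.card : ℝ) = ∑ n ∈ Ioc 0 R, ((R / n : ℕ) : ℝ) := by
    exact_mod_cast h1
  rw [h2]
  calc ∑ n ∈ Ioc 0 R, ((R / n : ℕ) : ℝ) ≤ ∑ n ∈ Ioc 0 R, (R : ℝ) * (n : ℝ)⁻¹ :=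
        sum_le_sum fun n _ ↦ Nat.cast_div_le
    _ = R * (harmonic R : ℝ) := by
        rw [harmonic_eq_sum_Icc, ← mul_sum]
        push_cast
        rfl
    _ ≤ _ := by
        gcongr
        exact harmonic_le_one_add_log R

lemma sum_abs_rem_pairSieve_le (h : ℕ) (hh : 2 ∣ h) (X : ℕ) {R : ℕ} (hR : 1 ≤ R) :
    ∑ d ∈ (pairSieve h hh X R).prodPrimes.divisors with d ≤ R,
      ∑ e ∈ (pairSieve h hh X R).prodPrimes.divisors with e ≤ R,
        |(pairSieve h hh X R).rem (d.lcm e)| ≤ (R * (1 + Real.log R)) ^ 2 := by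
  set s := pairSieve h hh X R
  have hrem : ∀ d, d ∣ s.prodPrimes → |s.rem d| ≤ (2 : ℝ) ^ d.primeFactors.card := by
    intro d hd
    have hd0 : 0 < d := Nat.pos_of_ne_zero (ne_zero_of_dvd_ne_zero prodPrimes_ne_zero hd)
    have h1 : s.rem d = (((range X).filter fun n ↦ d ∣ n * (n + h)).card : ℝ) -
        rootDensity h d * X := by
      simp only [rem, multSum]
      congr 1
      change ∑ n ∈ (range X).image (fun n ↦ n * (n + h)), (if d ∣ n then (1 : ℝ) else 0) = _
      rw [sum_image fun a _ b _ hab ↦ injective_mul_add h hab, ← sum_filter]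
      simp
    rw [h1]
    refine (abs_card_sub_rootDensity_le h X hd0).trans ?_
    exact_mod_cast rootCount_le_two_pow h (squarefree_of_dvd_prodPrimes hd)
  have hpow : ∀ d, d ≠ 0 → (2 : ℝ) ^ d.primeFactors.card ≤ d.divisors.card := by
    intro d hd
    have : 2 ^ d.primeFactors.card ≤ d.divisors.card := by
      rw [Nat.card_divisors hd, ← prod_const]
      refine prod_le_prod' fun p hp ↦ ?_
      have := (Nat.prime_of_mem_primeFactors hp).factorization_pos_of_dvd hd
        (Nat.dvd_of_mem_primeFactors hp)
      lia
    exact_mod_cast this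
  have hsum : ∑ d ∈ s.prodPrimes.divisors with d ≤ R, (2 : ℝ) ^ d.primeFactors.card ≤
      R * (1 + Real.log R) := by
    refine le_trans ?_ (sum_card_divisors_le hR)
    refine (sum_le_sum fun d hd ↦ hpow d ?_).trans
      (sum_le_sum_of_subset_of_nonneg ?_ fun _ _ _ ↦ by positivity)
    · exact (Nat.pos_of_mem_divisors (mem_filter.1 hd).1).ne'
    · intro d hd
      rw [mem_filter] at hd
      exact mem_Ioc.2 ⟨Nat.pos_of_mem_divisors hd.1, hd.2⟩
  calc _ ≤ ∑ d ∈ s.prodPrimes.divisors with d ≤ R, ∑ e ∈ s.prodPrimes.divisors with e ≤ R,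
        (2 : ℝ) ^ d.primeFactors.card * 2 ^ e.primeFactors.card := by
        refine sum_le_sum fun d hd ↦ sum_le_sum fun e he ↦ ?_
        have hd := (mem_filter.1 hd).1
        have he := (mem_filter.1 he).1
        refine (hrem _ (Nat.lcm_dvd (Nat.dvd_of_mem_divisors hd)
          (Nat.dvd_of_mem_divisors he))).trans ?_
        rw [← pow_add]
        refine pow_le_pow_right₀ one_le_two ((card_le_card ?_).trans (card_union_le _ _))
        intro p hp
        have hpp := Nat.prime_of_mem_primeFactors hp
        have hpd := (Nat.dvd_of_mem_primeFactors hp).trans (Nat.lcm_dvd_mul d e)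
        rw [mem_union, Nat.mem_primeFactors, Nat.mem_primeFactors]
        rcases hpp.dvd_mul.1 hpd with h' | h'
        · exact Or.inl ⟨hpp, h', (Nat.pos_of_mem_divisors hd).ne'⟩
        · exact Or.inr ⟨hpp, h', (Nat.pos_of_mem_divisors he).ne'⟩
    _ = (∑ d ∈ s.prodPrimes.divisors with d ≤ R, (2 : ℝ) ^ d.primeFactors.card) ^ 2 := by
        rw [sq, sum_mul_sum]
    _ ≤ _ := by gcongr

/-- The loss in the sieve main term at a prime `p ∣ h`. -/
noncomputable def localFactor (h p : ℕ) : ℝ := if p ∣ h then p / (p - 1) else 1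

lemma sq_log_le_prod_mul_selbergSum (h : ℕ) (hh : 2 ∣ h) (X : ℕ) {R : ℕ} (hR : 1 ≤ R) :
    Real.log R ^ 2 / 2 ≤
      (∏ p ∈ Nat.primesLE R, localFactor h p) * selbergSum (pairSieve h hh X R) R := by
  set s := pairSieve h hh X R
  refine (sq_log_le_divisorSum hR (S := Nat.primesLE R) ?_).trans
    (divisorSum_le_prod_mul_sum (g := s.selbergTerms) selbergTerms_isMultiplicative.map_one
      (fun m n hmn ↦ selbergTerms_isMultiplicative.map_mul_of_coprime hmn) _ ?_ R)
  · intro n hn p hp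
    rw [mem_Icc] at hn
    exact Nat.mem_primesLE.2 ⟨(Nat.le_of_mem_primeFactors hp).trans hn.2,
      Nat.prime_of_mem_primeFactors hp⟩
  · intro p hp
    have hp := (Nat.mem_primesLE.1 hp).2
    refine ⟨hp, ?_⟩
    have hg : s.selbergTerms p = rootDensity h p * (1 - rootDensity h p)⁻¹ := by
      rw [selbergTerms_apply, hp.primeFactors, prod_singleton]; rfl
    have hp1 : (1 : ℝ) < p := by exact_mod_cast hp.one_lt
    have hp1' : (p : ℝ) - 1 ≠ 0 := by linarith
    rw [hg, localFactor, rootDensity_apply, rootCount_prime h hp]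
    split_ifs with hd
    · refine Or.inl ⟨rfl, le_of_eq ?_⟩
      push_cast
      field_simp
    · refine Or.inr ⟨rfl, ?_⟩
      have hp2 : (2 : ℝ) < p := by
        have : p ≠ 2 := by rintro rfl; exact hd hh
        exact_mod_cast lt_of_le_of_ne hp.two_le this.symm
      have e : (((2 : ℕ) : ℝ) / p) * (1 - ((2 : ℕ) : ℝ) / p)⁻¹ = 2 / (p - 2) := by
        have : (p : ℝ) - 2 ≠ 0 := by linarith
        push_cast
        field_simp
      rw [e, div_le_div_iff₀ (by nlinarith) (by linarith)]
      nlinarith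

/-- The number of `p < X` with `p` and `p + h` both prime. -/
lemma card_prime_pairs_le {h : ℕ} (hh : 2 ∣ h) (X : ℕ) {R : ℕ} (hR : 2 ≤ R) :
    (((range X).filter fun p ↦ p.Prime ∧ (p + h).Prime).card : ℝ) ≤
      (R + 1) + (R * (1 + Real.log R)) ^ 2 +
        2 * X / Real.log R ^ 2 * ∏ p ∈ Nat.primesLE R, localFactor h p := by
  set s := pairSieve h hh X R with hs
  have hR1 : 1 ≤ R := by lia
  have hG := selbergSum_pos s hR1
  have hlog : 0 < Real.log R := Real.log_pos (by exact_mod_cast hR)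
  have h1 : (((range X).filter fun p ↦ p.Prime ∧ (p + h).Prime).card : ℝ) ≤
      (R + 1) + s.siftedSum := by
    have hsift : s.siftedSum =
        (((range X).filter fun n ↦ (primorial R).Coprime (n * (n + h))).card : ℝ) := by
      rw [siftedSum]
      change ∑ n ∈ (range X).image (fun n ↦ n * (n + h)),
        (if (primorial R).Coprime n then (1 : ℝ) else 0) = _
      rw [sum_image fun a _ b _ hab ↦ injective_mul_add h hab, ← sum_filter]
      simp
    rw [hsift]
    have hsub : ((range X).filter fun p ↦ p.Prime ∧ (p + h).Prime) ⊆
        range (R + 1) ∪ (range X).filter fun n ↦ (primorial R).Coprime (n * (n + h)) := by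
      intro p hp
      simp only [mem_filter, mem_union, mem_range] at hp ⊢
      obtain ⟨hX, hp1, hp2⟩ := hp
      by_cases hpR : p < R + 1
      · exact Or.inl hpR
      · refine Or.inr ⟨hX, Nat.Coprime.mul_right ?_ ?_⟩
        · rw [Nat.coprime_comm, hp1.coprime_iff_not_dvd, hp1.dvd_primorial_iff]; lia
        · rw [Nat.coprime_comm, hp2.coprime_iff_not_dvd, hp2.dvd_primorial_iff]; lia
    have := (card_le_card hsub).trans (card_union_le _ _)
    rw [card_range] at this
    exact_mod_cast this
  have h2 := siftedSum_le_selberg s hR1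
  have h3 := sum_abs_rem_pairSieve_le h hh X hR1
  have h4 := sq_log_le_prod_mul_selbergSum h hh X hR1
  have h5 : s.totalMass / selbergSum s R ≤
      2 * X / Real.log R ^ 2 * ∏ p ∈ Nat.primesLE R, localFactor h p := by
    change (X : ℝ) / _ ≤ _
    rw [div_le_iff₀ hG]
    have : (0 : ℝ) ≤ 2 * X / Real.log R ^ 2 := by positivity
    calc (X : ℝ) = 2 * X / Real.log R ^ 2 * (Real.log R ^ 2 / 2) := by field_simp
      _ ≤ 2 * X / Real.log R ^ 2 * ((∏ p ∈ Nat.primesLE R, localFactor h p) *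
          selbergSum s R) := by gcongr
      _ = _ := by ring
  linarith

end PrimePairs

section SingularSeries

open Finset

lemma prod_localFactor_le (R : ℕ) {k : ℕ} (hk : k ≠ 0) :
    ∏ p ∈ Nat.primesLE R, localFactor (2 * k) p ≤
      2 * ∑ d ∈ k.divisors with Odd d, 1 / √(d : ℝ) := by
  set T := k.primeFactors.erase 2 with hT
  have hTp : ∀ p ∈ T, p.Prime ∧ p ≠ 2 ∧ p ∣ k := fun p hp ↦
    ⟨Nat.prime_of_mem_primeFactors (mem_of_mem_erase hp), ne_of_mem_erase hp,
      Nat.dvd_of_mem_primeFactors (mem_of_mem_erase hp)⟩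
  have h2T : 2 ∉ T := notMem_erase 2 _
  have hone : ∀ p : ℕ, p.Prime → (1 : ℝ) ≤ p / (p - 1) := by
    intro p hp
    have : (1 : ℝ) < p := by exact_mod_cast hp.one_lt
    rw [one_le_div (by linarith)]; linarith
  have h1 : ∏ p ∈ Nat.primesLE R, localFactor (2 * k) p ≤
      ∏ p ∈ insert 2 T, ((p : ℝ) / (p - 1)) := by
    simp only [localFactor]
    rw [← prod_filter]
    have hsub : {p ∈ Nat.primesLE R | p ∣ 2 * k} ⊆ insert 2 T := by
      intro p hp
      obtain ⟨hp1, hp2⟩ := mem_filter.1 hp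
      have hpp := (Nat.mem_primesLE.1 hp1).2
      rw [mem_insert]
      by_cases h2 : p = 2
      · exact Or.inl h2
      · refine Or.inr (mem_erase.2 ⟨h2, Nat.mem_primeFactors.2 ⟨hpp, ?_, hk⟩⟩)
        exact (hpp.dvd_mul.1 hp2).resolve_left
          fun h ↦ h2 ((Nat.prime_dvd_prime_iff_eq hpp Nat.prime_two).1 h)
    rw [← prod_sdiff hsub]
    refine le_mul_of_one_le_left ?_ ?_
    · exact prod_nonneg fun p hp ↦
        zero_le_one.trans (hone p (Nat.mem_primesLE.1 (mem_filter.1 hp).1).2)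
    · refine one_le_prod fun p hp ↦ hone p ?_
      rcases mem_insert.1 (mem_sdiff.1 hp).1 with rfl | h
      · exact Nat.prime_two
      · exact (hTp p h).1
  have h3 : ∏ p ∈ T, ((p : ℝ) / (p - 1)) ≤ ∏ p ∈ T, (1 + 1 / √(p : ℝ)) := by
    refine prod_le_prod (fun p hp ↦ zero_le_one.trans (hone p (hTp p hp).1)) fun p hp ↦ ?_
    obtain ⟨hp1, hp2, -⟩ := hTp p hp
    have h3 : (3 : ℝ) ≤ p := by
      have := hp1.two_le
      have : 3 ≤ p := by lia
      exact_mod_cast this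
    have hs : √(p : ℝ) ≤ p - 1 := Real.sqrt_le_iff.2 ⟨by linarith, by nlinarith⟩
    have hs0 : 0 < √(p : ℝ) := Real.sqrt_pos.2 (by linarith)
    have := one_div_le_one_div_of_le hs0 hs
    have e : (p : ℝ) / (p - 1) = 1 + 1 / (p - 1) := by
      have : (p : ℝ) - 1 ≠ 0 := by linarith
      field_simp; ring
    linarith
  have h4 : ∏ p ∈ T, (1 + 1 / √(p : ℝ)) ≤ ∑ d ∈ k.divisors with Odd d, 1 / √(d : ℝ) := by
    have e : ∀ U ∈ T.powerset, ∏ p ∈ U, 1 / √(p : ℝ) = 1 / √((∏ p ∈ U, p : ℕ) : ℝ) := by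
      intro U _
      rw [prod_div_distrib, prod_const_one, Nat.cast_prod, Real.sqrt_prod _ fun _ _ ↦ by positivity]
    have hpf : ∀ U ∈ T.powerset, (∏ p ∈ U, p).primeFactors = U := fun U hU ↦
      Nat.primeFactors_prod fun p hp ↦ (hTp p (mem_powerset.1 hU hp)).1
    rw [prod_one_add, sum_congr rfl e,
      ← sum_image (f := fun d : ℕ ↦ 1 / √(d : ℝ)) (g := fun U : Finset ℕ ↦ ∏ p ∈ U, p)]
    · refine sum_le_sum_of_subset_of_nonneg ?_ fun _ _ _ ↦ by positivity
      intro d hd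
      obtain ⟨U, hU, rfl⟩ := mem_image.1 hd
      have hUT := mem_powerset.1 hU
      refine mem_filter.2 ⟨Nat.mem_divisors.2 ⟨?_, hk⟩, ?_⟩
      · exact (prod_dvd_prod_of_subset _ _ _ (hUT.trans (erase_subset _ _))).trans
          (Nat.prod_primeFactors_dvd k)
      · refine prod_induction _ Odd (fun _ _ ↦ Odd.mul) odd_one fun p hp ↦ ?_
        obtain ⟨h1, h2, -⟩ := hTp p (hUT hp)
        exact h1.odd_of_ne_two h2
    · intro U hU V hV h
      rw [← hpf U hU, ← hpf V hV]
      exact congrArg Nat.primeFactors h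
  rw [prod_insert h2T] at h1
  have e2 : ((2 : ℕ) : ℝ) / ((2 : ℕ) - 1) = 2 := by norm_num
  rw [e2] at h1
  linarith

lemma sum_odd_le (n : ℕ) :
    ∑ j ∈ range (n + 1), 1 / ((2 * j + 1 : ℝ) * √(2 * j + 1)) ≤
      1 + 1 / √2 - 1 / √(2 * n + 2) := by
  induction n with
  | zero => simp
  | succ n ih =>
    rw [sum_range_succ]
    refine (add_le_add_left ih _).trans ?_
    push_cast
    have hn : (0 : ℝ) ≤ n := by positivity
    set m : ℝ := 2 * (n + 1) + 1 with hm
    have hm3 : 3 ≤ m := by linarith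
    rw [show (2 * n + 2 : ℝ) = m - 1 by rw [hm]; ring,
      show (2 * (n + 1) + 2 : ℝ) = m + 1 by rw [hm]; ring]
    set a := √(m - 1)
    set b := √(m + 1)
    set c := √m
    have ha : 0 < a := Real.sqrt_pos.2 (by linarith)
    have hb : 0 < b := Real.sqrt_pos.2 (by linarith)
    have hc : 0 < c := Real.sqrt_pos.2 (by linarith)
    have ha2 : a ^ 2 = m - 1 := Real.sq_sqrt (by linarith)
    have hb2 : b ^ 2 = m + 1 := Real.sq_sqrt (by linarith)
    have hc2 : c ^ 2 = m := Real.sq_sqrt (by linarith)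
    have hab : a * b ≤ m := abs_le_of_sq_le_sq' (by rw [mul_pow, ha2, hb2]; nlinarith)
      (by linarith) |>.2
    have habc : a + b ≤ 2 * c := abs_le_of_sq_le_sq' (by nlinarith) (by linarith) |>.2
    have e : 1 / a - 1 / b = 2 / (a * b * (a + b)) := by
      rw [div_sub_div _ _ ha.ne' hb.ne', div_eq_div_iff (by positivity) (by positivity)]
      linear_combination (a * b) * (hb2 - ha2)
    have h1 : 1 / (m * c) ≤ 2 / (a * b * (a + b)) := by
      rw [div_le_div_iff₀ (by positivity) (by positivity)]
      have := mul_le_mul hab habc (by positivity) (by linarith)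
      linarith
    linarith

lemma sum_sum_odd_divisors_le (K : ℕ) :
    ∑ k ∈ Ioc 0 K, ∑ d ∈ k.divisors with Odd d, 1 / √(d : ℝ) ≤ K * (1 + 1 / √2) := by
  have h1 : ∀ k ∈ Ioc 0 K, ∑ d ∈ k.divisors with Odd d, 1 / √(d : ℝ) =
      ∑ d ∈ Ioc 0 K with Odd d, if d ∣ k then 1 / √(d : ℝ) else 0 := by
    intro k hk
    rw [mem_Ioc] at hk
    rw [← sum_filter]
    refine sum_congr ?_ fun _ _ ↦ rfl
    ext d
    simp only [mem_filter, Nat.mem_divisors, mem_Ioc]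
    constructor
    · rintro ⟨⟨h, -⟩, ho⟩
      exact ⟨⟨⟨Nat.pos_of_dvd_of_pos h hk.1, (Nat.le_of_dvd hk.1 h).trans hk.2⟩, ho⟩, h⟩
    · rintro ⟨⟨-, ho⟩, h⟩
      exact ⟨⟨h, by lia⟩, ho⟩
  rw [sum_congr rfl h1, sum_comm]
  calc _ ≤ ∑ d ∈ Ioc 0 K with Odd d, (K : ℝ) * (1 / (d * √(d : ℝ))) := by
        refine sum_le_sum fun d hd ↦ ?_
        rw [← sum_filter, sum_const, Nat.Ioc_filter_dvd_card_eq_div, nsmul_eq_mul]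
        have : ((K / d : ℕ) : ℝ) ≤ K / d := Nat.cast_div_le
        calc ((K / d : ℕ) : ℝ) * (1 / √(d : ℝ)) ≤ K / d * (1 / √(d : ℝ)) := by gcongr
          _ = _ := by rw [div_mul_div_comm, mul_one, mul_one_div]
    _ = K * ∑ d ∈ Ioc 0 K with Odd d, 1 / (d * √(d : ℝ)) := by rw [mul_sum]
    _ ≤ K * ∑ j ∈ range (K + 1), 1 / ((2 * j + 1 : ℝ) * √(2 * j + 1)) := by
        gcongr
        have hinj : Set.InjOn (fun j : ℕ ↦ 2 * j + 1) (range (K + 1)) := by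
          intro a _ b _ h; simp only at h; lia
        have : ∑ j ∈ range (K + 1), 1 / ((2 * j + 1 : ℝ) * √(2 * j + 1)) =
            ∑ d ∈ (range (K + 1)).image (fun j : ℕ ↦ 2 * j + 1), 1 / ((d : ℝ) * √(d : ℝ)) := by
          rw [sum_image hinj]; push_cast; rfl
        rw [this]
        refine sum_le_sum_of_subset_of_nonneg ?_ fun _ _ _ ↦ by positivity
        intro d hd
        obtain ⟨h1, j, rfl⟩ := mem_filter.1 hd
        rw [mem_Ioc] at h1
        exact mem_image.2 ⟨j, mem_range.2 (by lia), rfl⟩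
    _ ≤ _ := by
        gcongr
        have := sum_odd_le K
        have : 0 ≤ 1 / √(2 * K + 2 : ℝ) := by positivity
        linarith

end SingularSeries

section SmallGapCount

open Finset Filter

lemma nextPrime_spec (p : ℕ) : p < nextPrime p ∧ (nextPrime p).Prime := by
  obtain ⟨q, hq, hqp⟩ := Nat.exists_infinite_primes (p + 1)
  exact Nat.sInf_mem (s := {q : ℕ | p < q ∧ q.Prime}) ⟨q, hq, hqp⟩

lemma exists_primeGap_eq_two_mul {p : ℕ} (hp : p.Prime) (h2 : p ≠ 2) :
    ∃ k, 0 < k ∧ primeGap p = 2 * k ∧ (p + 2 * k).Prime := by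
  obtain ⟨h, hq⟩ := nextPrime_spec p
  have ho := hp.odd_of_ne_two h2
  have hqo := hq.odd_of_ne_two (by have := hp.two_le; lia)
  obtain ⟨a, ha⟩ := ho
  obtain ⟨b, hb⟩ := hqo
  refine ⟨b - a, by lia, by rw [primeGap]; lia, ?_⟩
  rwa [show p + 2 * (b - a) = nextPrime p by lia]

/-- The primes `p < X` whose gap to the next prime is less than `ε log p`. -/
noncomputable def smallGapPrimes (ε : ℝ) (X : ℕ) : Finset ℕ :=
  (range X).filter fun p ↦ p.Prime ∧ (primeGap p : ℝ) < ε * Real.log p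

lemma card_smallGapPrimes_le_sum (ε : ℝ) (hε : 0 < ε) (X : ℕ) :
    (smallGapPrimes ε X).card ≤ 1 + ∑ k ∈ Ioc 0 ⌊ε * Real.log X / 2⌋₊,
      ((range X).filter fun p ↦ p.Prime ∧ (p + 2 * k).Prime).card := by
  have hsub : smallGapPrimes ε X ⊆ {2} ∪ (Ioc 0 ⌊ε * Real.log X / 2⌋₊).biUnion fun k ↦
      (range X).filter fun p ↦ p.Prime ∧ (p + 2 * k).Prime := by
    intro p hp
    obtain ⟨hpX, hp, hgap⟩ := mem_filter.1 hp
    rw [mem_union, mem_singleton]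
    by_cases h2 : p = 2
    · exact Or.inl h2
    obtain ⟨k, hk, hpk, hprime⟩ := exists_primeGap_eq_two_mul hp h2
    refine Or.inr (mem_biUnion.2 ⟨k, mem_Ioc.2 ⟨hk, Nat.le_floor ?_⟩,
      mem_filter.2 ⟨hpX, hp, hprime⟩⟩)
    have hlog : Real.log p ≤ Real.log X :=
      Real.log_le_log (by exact_mod_cast hp.pos) (by exact_mod_cast (mem_range.1 hpX).le)
    have := mul_le_mul_of_nonneg_left hlog hε.le
    rw [hpk] at hgap
    push_cast at hgap
    linarith
  calc _ ≤ _ := card_le_card hsub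
    _ ≤ _ := card_union_le _ _
    _ ≤ _ := by rw [card_singleton]; gcongr; exact card_biUnion_le

lemma card_smallGapPrimes_le {ε : ℝ} (hε : 0 < ε) {X R : ℕ} (hX : 1 ≤ X) (hR : 2 ≤ R) :
    ((smallGapPrimes ε X).card : ℝ) ≤
      1 + ε * Real.log X / 2 * ((R + 1) + (R * (1 + Real.log R)) ^ 2) +
        2 * (1 + 1 / √2) * ε * X * Real.log X / Real.log R ^ 2 := by
  set K := ⌊ε * Real.log X / 2⌋₊ with hK
  have hlogX : 0 ≤ Real.log X := Real.log_natCast_nonneg X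
  have hKle : (K : ℝ) ≤ ε * Real.log X / 2 := Nat.floor_le (by positivity)
  have hlogR : 0 ≤ Real.log R := Real.log_natCast_nonneg R
  set E : ℝ := (R + 1) + (R * (1 + Real.log R)) ^ 2 with hE
  have hE0 : 0 ≤ E := by positivity
  set A : ℝ := 2 * X / Real.log R ^ 2 with hA
  have hA0 : 0 ≤ A := by positivity
  have h1 : ((smallGapPrimes ε X).card : ℝ) ≤ 1 + ∑ k ∈ Ioc 0 K,
      (((range X).filter fun p ↦ p.Prime ∧ (p + 2 * k).Prime).card : ℝ) := by
    exact_mod_cast card_smallGapPrimes_le_sum ε hε X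
  have h2 : ∑ k ∈ Ioc 0 K,
      (((range X).filter fun p ↦ p.Prime ∧ (p + 2 * k).Prime).card : ℝ) ≤
      ∑ k ∈ Ioc 0 K, (E + A * (2 * ∑ d ∈ k.divisors with Odd d, 1 / √(d : ℝ))) := by
    refine sum_le_sum fun k hk ↦ (card_prime_pairs_le (dvd_mul_right 2 k) X hR).trans ?_
    gcongr
    exact prod_localFactor_le R (mem_Ioc.1 hk).1.ne'
  rw [sum_add_distrib, ← mul_sum, ← mul_sum, sum_const, Nat.card_Ioc, nsmul_eq_mul,
    Nat.sub_zero] at h2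
  have h3 : (K : ℝ) * E + A * (2 * ∑ k ∈ Ioc 0 K, ∑ d ∈ k.divisors with Odd d, 1 / √(d : ℝ)) ≤
      ε * Real.log X / 2 * E + A * (2 * (ε * Real.log X / 2 * (1 + 1 / √2))) := by
    gcongr
    exact (sum_sum_odd_divisors_le K).trans (by gcongr)
  have h4 : A * (2 * (ε * Real.log X / 2 * (1 + 1 / √2))) =
      2 * (1 + 1 / √2) * ε * X * Real.log X / Real.log R ^ 2 := by
    rw [hA]; ring
  linarith

lemma sieve_error_le {x r : ℝ} (hx : 1 ≤ x) (hr : 2 ≤ r) (hrx : r ≤ 2 * x ^ (0.47 : ℝ))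
    (hlog : 2 + Real.log x ≤ x ^ (0.01 : ℝ)) :
    Real.log x / 2 * ((r + 1) + (r * (1 + Real.log r)) ^ 2) ≤ 6 * x ^ (0.97 : ℝ) := by
  have hx0 : 0 < x := by linarith
  have hlogx : 0 ≤ Real.log x := Real.log_nonneg hx
  have hlogr0 : 0 ≤ Real.log r := Real.log_nonneg (by linarith)
  have hlogr : Real.log r ≤ 1 + Real.log x := by
    have h1 : Real.log r ≤ Real.log (2 * x ^ (0.47 : ℝ)) := Real.log_le_log (by linarith) hrx
    rw [Real.log_mul (by norm_num) (by positivity), Real.log_rpow hx0] at h1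
    have := Real.log_two_lt_d9
    linarith
  set y := x ^ (0.01 : ℝ) with hy
  have hy0 : 0 < y := by positivity
  have h1 : r * (1 + Real.log r) ≤ 2 * x ^ (0.47 : ℝ) * y := by
    gcongr; linarith
  have hr1 : r ≤ r * (1 + Real.log r) := le_mul_of_one_le_right (by linarith) (by linarith)
  set z := r * (1 + Real.log r) with hz
  have h2 : (r + 1) + z ^ 2 ≤ 3 * z ^ 2 := by nlinarith
  have h3 : x ^ (0.97 : ℝ) = y * (x ^ (0.47 : ℝ) * y) ^ 2 := by
    rw [hy, ← Real.rpow_add hx0, ← Real.rpow_natCast, ← Real.rpow_mul hx0.le,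
      ← Real.rpow_add hx0]
    norm_num
  calc Real.log x / 2 * ((r + 1) + z ^ 2) ≤ y / 2 * (3 * (2 * x ^ (0.47 : ℝ) * y) ^ 2) := by
        have : z ^ 2 ≤ (2 * x ^ (0.47 : ℝ) * y) ^ 2 := by
          have : 0 ≤ z := by linarith
          gcongr
        gcongr
        · linarith
        · linarith
    _ = _ := by rw [h3]; ring

lemma eventually_card_smallGapPrimes_le {ε : ℝ} (hε : 0 < ε) :
    ∀ᶠ X : ℕ in atTop, ((smallGapPrimes ε X).card : ℝ) ≤ 15.6 * ε * (X / Real.log X) := by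
  have hcast := tendsto_natCast_atTop_atTop (R := ℝ)
  have hlog : ∀ᶠ x : ℝ in atTop, 2 + Real.log x ≤ x ^ (0.01 : ℝ) := by
    have h1 := (isLittleO_log_rpow_atTop (r := 0.01) (by norm_num)).bound
      (show (0 : ℝ) < 1 / 2 by norm_num)
    have h2 := (tendsto_rpow_atTop (y := 0.01) (by norm_num)).eventually_ge_atTop 4
    filter_upwards [h1, h2, eventually_ge_atTop 1] with x hx1 hx2 hx3
    rw [Real.norm_of_nonneg (Real.log_nonneg hx3), Real.norm_of_nonneg (by positivity)] at hx1
    linarith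
  have hbig : ∀ᶠ x : ℝ in atTop, 1 + 6 * ε * x ^ (0.97 : ℝ) ≤ 0.14 * ε * x ^ (0.99 : ℝ) := by
    have h1 := (tendsto_rpow_atTop (y := 0.99) (by norm_num)).eventually_ge_atTop (1 / (0.07 * ε))
    have h2 := (tendsto_rpow_atTop (y := 0.02) (by norm_num)).eventually_ge_atTop (6 / 0.07)
    filter_upwards [h1, h2, eventually_gt_atTop 0] with x hx1 hx2 hx3
    rw [div_le_iff₀ (by positivity)] at hx1
    have h3 : x ^ (0.99 : ℝ) = x ^ (0.02 : ℝ) * x ^ (0.97 : ℝ) := by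
      rw [← Real.rpow_add hx3]; norm_num
    have h4 : 6 * x ^ (0.97 : ℝ) ≤ 0.07 * x ^ (0.99 : ℝ) := by
      rw [h3]
      have := mul_le_mul_of_nonneg_right hx2 (Real.rpow_nonneg hx3.le (0.97 : ℝ))
      linarith
    nlinarith
  filter_upwards [hcast.eventually hlog, hcast.eventually hbig, eventually_ge_atTop 2]
    with X h1 h2 hX
  have hX1 : (1 : ℝ) < X := by exact_mod_cast hX
  have hX0 : (0 : ℝ) < X := by linarith
  have hlogX : 0 < Real.log X := Real.log_pos hX1
  set R := ⌈(X : ℝ) ^ (0.47 : ℝ)⌉₊ with hR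
  have hpow : 1 < (X : ℝ) ^ (0.47 : ℝ) := Real.one_lt_rpow hX1 (by norm_num)
  have hRge : (X : ℝ) ^ (0.47 : ℝ) ≤ R := Nat.le_ceil _
  have hR2 : 2 ≤ R := Nat.lt_ceil.2 (by exact_mod_cast hpow)
  have hRle : (R : ℝ) ≤ 2 * (X : ℝ) ^ (0.47 : ℝ) := by
    have : (R : ℝ) < (X : ℝ) ^ (0.47 : ℝ) + 1 := Nat.ceil_lt_add_one (zero_lt_one.trans hpow).le
    linarith
  have hlogR : 0.47 * Real.log X ≤ Real.log R := by
    rw [← Real.log_rpow hX0]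
    exact Real.log_le_log (by positivity) hRge
  have herr := sieve_error_le hX1.le (by exact_mod_cast hR2) hRle h1
  have hmain : 2 * (1 + 1 / √2) * ε * X * Real.log X / Real.log R ^ 2 ≤
      15.46 * ε * (X / Real.log X) := by
    have hs : 1 / √2 ≤ (0.7072 : ℝ) := by
      rw [div_le_iff₀ (by positivity)]
      have : (1.4141 : ℝ) ≤ √2 := Real.le_sqrt_of_sq_le (by norm_num)
      linarith
    calc _ ≤ 2 * (1 + 0.7072) * ε * X * Real.log X / (0.47 * Real.log X) ^ 2 := by gcongr
      _ = 2 * (1 + 0.7072) / 0.47 ^ 2 * ε * (X / Real.log X) := by field_simp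
      _ ≤ _ := by gcongr; norm_num
  have hsmall : (X : ℝ) ^ (0.99 : ℝ) ≤ X / Real.log X := by
    rw [le_div_iff₀ hlogX]
    calc _ ≤ (X : ℝ) ^ (0.99 : ℝ) * (X : ℝ) ^ (0.01 : ℝ) := by gcongr; linarith
      _ = X := by rw [← Real.rpow_add hX0]; norm_num
  have h3 := card_smallGapPrimes_le hε (by lia : 1 ≤ X) hR2
  have h4 := mul_le_mul_of_nonneg_left herr hε.le
  have h5 := mul_le_mul_of_nonneg_left hsmall (show 0 ≤ 0.14 * ε by positivity)
  have h6 : ε * Real.log X / 2 * ((R + 1) + (R * (1 + Real.log R)) ^ 2) =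
    ε * (Real.log X / 2 * ((R + 1) + (R * (1 + Real.log R)) ^ 2)) := by ring
  rw [h6] at h3
  linarith

end SmallGapCount

section PartialSummation

open Finset Filter

lemma le_sum_mul_of_antitone {c g : ℕ → ℝ} {K : ℝ} (hg : Antitone g)
    (hc : ∀ n, -K ≤ ∑ j ∈ range n, c j) (n : ℕ) :
    (∑ j ∈ range n, c j + K) * g n - K * g 0 ≤ ∑ j ∈ range n, c j * g j := by
  induction n with
  | zero => simp
  | succ n ih =>
    have h1 := mul_le_mul_of_nonneg_left (hg n.le_succ)
      (show 0 ≤ ∑ j ∈ range (n + 1), c j + K by linarith [hc (n + 1)])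
    rw [sum_range_succ _ n] at h1 ⊢
    rw [sum_range_succ]
    nlinarith

lemma exists_card_smallGapPrimes_le {ε : ℝ} (hε : 0 < ε) :
    ∃ K : ℝ, ∀ n : ℕ, ((smallGapPrimes ε (n + 3)).card : ℝ) ≤
      K + ∑ j ∈ range n, 15.6 * ε / Real.log (j + 3) := by
  obtain ⟨N, hN⟩ := eventually_atTop.1 (eventually_card_smallGapPrimes_le hε)
  refine ⟨N + 3 * (15.6 * ε), fun n ↦ ?_⟩
  have hlog : ∀ j : ℕ, 1 ≤ Real.log (j + 3) := fun j ↦ by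
    rw [Real.le_log_iff_exp_le (by positivity)]
    have : (0 : ℝ) ≤ j := by positivity
    linarith [Real.exp_one_lt_d9]
  have hsum : n * (15.6 * ε / Real.log (n + 3)) ≤
      ∑ j ∈ range n, 15.6 * ε / Real.log (j + 3) := by
    rw [← nsmul_eq_mul, ← card_range n, ← sum_const, card_range]
    refine sum_le_sum fun j hj ↦ ?_
    have : (j : ℝ) ≤ n := by exact_mod_cast (mem_range.1 hj).le
    have := hlog j
    gcongr
  have hpos : 0 ≤ 15.6 * ε / Real.log (n + 3) :=
    div_nonneg (by positivity) (zero_le_one.trans (hlog n))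
  rcases le_total N (n + 3) with h | h
  · have h1 := hN _ h
    push_cast at h1
    have h2 : 15.6 * ε * ((n + 3) / Real.log (n + 3)) =
        n * (15.6 * ε / Real.log (n + 3)) + 3 * (15.6 * ε / Real.log (n + 3)) := by ring
    have h3 : 15.6 * ε / Real.log (n + 3) ≤ 15.6 * ε := div_le_self (by positivity) (hlog n)
    have : (0 : ℝ) ≤ N := by positivity
    linarith
  · have h1 : (smallGapPrimes ε (n + 3)).card ≤ N :=
      (card_filter_le _ _).trans ((card_range _).trans_le h)
    have h2 : ((smallGapPrimes ε (n + 3)).card : ℝ) ≤ N := by exact_mod_cast h1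
    have : 0 ≤ n * (15.6 * ε / Real.log (n + 3)) := by positivity
    have : 0 ≤ 3 * (15.6 * ε) := by positivity
    linarith

lemma sum_one_div_add_three_le (n : ℕ) :
    ∑ j ∈ range n, 1 / ((j : ℝ) + 3) ≤ 1 + Real.log n := by
  have h := harmonic_le_one_add_log n
  rw [harmonic] at h
  push_cast at h
  refine le_trans (sum_le_sum fun j _ ↦ ?_) h
  rw [← one_div]
  gcongr
  norm_num

lemma exists_sum_smallGapPrimes_le {ε : ℝ} (hε : 0 < ε) :
    ∃ B : ℝ, ∀ n : ℕ, ∑ p ∈ smallGapPrimes ε (n + 3), Real.log p / p ≤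
      B + 15.6 * ε * Real.log n := by
  obtain ⟨K, hK⟩ := exists_card_smallGapPrimes_le hε
  let P : ℕ → Prop := fun p ↦ p.Prime ∧ (primeGap p : ℝ) < ε * Real.log p
  classical
  let a : ℕ → ℝ := fun p ↦ if P p then 1 else 0
  let g : ℕ → ℝ := fun j ↦ Real.log (j + 3) / (j + 3)
  let c : ℕ → ℝ := fun j ↦ 15.6 * ε / Real.log (j + 3) - a (3 + j)
  have ha : ∀ p, 0 ≤ a p := fun p ↦ by simp only [a]; split_ifs <;> norm_num
  have hg : Antitone g := by
    intro i j hij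
    have he := Real.exp_one_lt_d9
    have : (i : ℝ) ≤ j := by exact_mod_cast hij
    have : (0 : ℝ) ≤ i := by positivity
    exact Real.log_div_self_antitoneOn (show Real.exp 1 ≤ i + 3 by linarith)
      (show Real.exp 1 ≤ j + 3 by linarith) (by linarith)
  have hsmall : ∀ (n : ℕ) (F : ℕ → ℝ), ∑ p ∈ smallGapPrimes ε (n + 3), F p =
      ∑ p ∈ range 3, a p * F p + ∑ j ∈ range n, a (3 + j) * F (3 + j) := by
    intro n F
    rw [← sum_range_add (fun p ↦ a p * F p), smallGapPrimes, add_comm n, sum_filter]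
    refine sum_congr rfl fun p _ ↦ ?_
    simp only [a, P, ite_mul, one_mul, zero_mul]
  have hc : ∀ n, -K ≤ ∑ j ∈ range n, c j := by
    intro n
    have h1 := hK n
    have h2 := hsmall n fun _ ↦ 1
    rw [sum_const, nsmul_eq_mul, mul_one] at h2
    simp only [mul_one] at h2
    have h3 : 0 ≤ ∑ p ∈ range 3, a p := sum_nonneg fun p _ ↦ ha p
    rw [sum_sub_distrib]
    linarith
  refine ⟨∑ p ∈ range 3, a p * (Real.log p / p) + K * g 0 + 15.6 * ε, fun n ↦ ?_⟩
  have hmain := le_sum_mul_of_antitone hg hc n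
  have h1 : 0 ≤ (∑ j ∈ range n, c j + K) * g n := by
    refine mul_nonneg (by linarith [hc n]) (div_nonneg (Real.log_nonneg ?_) (by positivity))
    have : (0 : ℝ) ≤ n := by positivity
    linarith
  have h2 : ∑ j ∈ range n, c j * g j = 15.6 * ε * ∑ j ∈ range n, 1 / ((j : ℝ) + 3) -
      ∑ j ∈ range n, a (3 + j) * (Real.log (3 + j : ℕ) / (3 + j : ℕ)) := by
    rw [mul_sum, ← sum_sub_distrib]
    refine sum_congr rfl fun j _ ↦ ?_
    have hj : (0 : ℝ) ≤ j := by positivity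
    have hl : Real.log (j + 3) ≠ 0 := (Real.log_pos (by linarith)).ne'
    simp only [c, g]
    push_cast
    rw [add_comm (3 : ℝ)]
    field_simp
  have h3 := mul_le_mul_of_nonneg_left (sum_one_div_add_three_le n)
    (show 0 ≤ 15.6 * ε by positivity)
  rw [hsmall n fun p ↦ Real.log p / p]
  linarith

end PartialSummation

end SmallGaps

theorem limsup_small_gap_primes (ε : ℝ) (hε : 0 < ε) :
    Filter.limsup
      (fun x : ℝ => (1 / Real.log x) *
        ∑ p ∈ (Finset.range (⌊x⌋₊ + 1)).filter
            (fun p => p.Prime ∧ (primeGap p : ℝ) < ε * Real.log p),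
          Real.log p / p)
      Filter.atTop ≤ 16 * ε := by
  obtain ⟨B, hB⟩ := SmallGaps.exists_sum_smallGapPrimes_le hε
  refine Filter.limsup_le_of_le ?_ ?_
  · refine Filter.IsCoboundedUnder.of_frequently_ge (a := 0) (Filter.Eventually.frequently ?_)
    filter_upwards [Filter.eventually_ge_atTop 1] with x hx
    have := Real.log_nonneg hx
    refine mul_nonneg (by positivity) (Finset.sum_nonneg fun p _ ↦ ?_)
    exact div_nonneg (Real.log_natCast_nonneg p) (by positivity)
  · filter_upwards [Filter.eventually_ge_atTop 3,
      Real.tendsto_log_atTop.eventually_ge_atTop (B / (0.4 * ε))] with x hx hBx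
    have hlog : 0 < Real.log x := Real.log_pos (by linarith)
    rw [div_le_iff₀ (by positivity)] at hBx
    have hfloor : 3 ≤ ⌊x⌋₊ := Nat.le_floor (by exact_mod_cast hx)
    have h := hB (⌊x⌋₊ - 2)
    rw [show ⌊x⌋₊ - 2 + 3 = ⌊x⌋₊ + 1 by lia] at h
    have hle : Real.log (⌊x⌋₊ - 2 : ℕ) ≤ Real.log x := by
      refine Real.log_le_log (by exact_mod_cast (by lia : 0 < ⌊x⌋₊ - 2)) ?_
      exact le_trans (by exact_mod_cast Nat.sub_le _ _) (Nat.floor_le (by linarith))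
    have h2 := mul_le_mul_of_nonneg_left hle (show 0 ≤ 15.6 * ε by positivity)
    rw [one_div, inv_mul_le_iff₀ hlog]
    refine h.trans ?_
    linarith
end

section
/- For every real y ≥ 1, ∑_{d=1}^{⌊y⌋} F(d) ≤ y · ∏_{p prime, p>2} (1 + 1/(p(p−2))), where F(d) = ∏_{p | d, p prime, p>2} (p−1)/(p−2). -/
open scoped BigOperators

/-- `F d = ∏_{p ∣ d, p prime, p > 2} (p-1)/(p-2)`. -/
noncomputable def F (d : ℕ) : ℝ :=
  ∏ p ∈ d.primeFactors.filter (fun p => 2 < p), ((p : ℝ) - 1) / ((p : ℝ) - 2)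

/-- A finite partial product of real factors at least one is at most the infinite product. -/
lemma prod_le_tprod_of_one_le {ι : Type*} {f : ι → ℝ} (hf : Multipliable f) (h : ∀ i, 1 ≤ f i)
    (s : Finset ι) : ∏ i ∈ s, f i ≤ ∏' i, f i := by
  classical
  refine ge_of_tendsto hf.hasProd ?_
  rw [SummationFilter.unconditional_filter]
  filter_upwards [Filter.eventually_ge_atTop s] with t hst
  rw [← Finset.prod_sdiff hst]
  exact le_mul_of_one_le_left (Finset.prod_nonneg fun i _ => zero_le_one.trans (h i))
    (Finset.prod_induction f (1 ≤ ·) (fun _ _ => one_le_mul_of_one_le_of_one_le) le_rfl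
      fun i _ => h i)

lemma card_Icc_filter_dvd_le (n m : ℕ) :
    (((Finset.Icc 1 n).filter (m ∣ ·)).card : ℝ) ≤ n / m := by
  have := Nat.Ioc_filter_dvd_card_eq_div n m
  rw [show Finset.Icc 1 n = Finset.Ioc 0 n from rfl, this]
  exact Nat.cast_div_le

/-- The sum over `d ≤ n` of `∏_{p ∣ d, p ∈ s} (1 + g p)`, for `s` a finite set of primes. -/
lemma sum_prod_one_add_le (n : ℕ) (s : Finset ℕ) (hs : ∀ p ∈ s, p.Prime) (g : ℕ → ℝ)
    (hg : ∀ p ∈ s, 0 ≤ g p) :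
    ∑ d ∈ Finset.Icc 1 n, ∏ p ∈ s.filter (· ∣ d), (1 + g p) ≤
      n * ∏ p ∈ s, (1 + g p / p) := by
  have expand (d : ℕ) : ∏ p ∈ s.filter (· ∣ d), (1 + g p) =
      ∑ t ∈ s.powerset, if ∏ p ∈ t, p ∣ d then ∏ p ∈ t, g p else 0 := by
    rw [Finset.prod_one_add, ← Finset.sum_filter]
    refine Finset.sum_congr ?_ fun _ _ => rfl
    ext t
    simp only [Finset.mem_powerset, Finset.mem_filter, Finset.subset_iff]
    constructor
    · intro h
      exact ⟨fun p hp => (h hp).1, Finset.prod_primes_dvd d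
        (fun p hp => (hs p (h hp).1).prime) fun p hp => (h hp).2⟩
    · rintro ⟨h, hd⟩ p hp
      exact ⟨h hp, (Finset.dvd_prod_of_mem _ hp).trans hd⟩
  simp_rw [expand]
  rw [Finset.sum_comm, Finset.prod_one_add, Finset.mul_sum]
  refine Finset.sum_le_sum fun t ht => ?_
  rw [← Finset.sum_filter, Finset.sum_const, nsmul_eq_mul, Finset.prod_div_distrib]
  have h := card_Icc_filter_dvd_le n (∏ p ∈ t, p)
  push_cast at h
  calc _ ≤ (n / ∏ p ∈ t, (p : ℝ)) * ∏ p ∈ t, g p := mul_le_mul_of_nonneg_right h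
        (Finset.prod_nonneg fun p hp => hg p (Finset.mem_powerset.1 ht hp))
    _ = _ := by ring

lemma summable_one_div_mul_sub_two :
    Summable fun p : {p : ℕ // p.Prime ∧ 2 < p} => (1 / ((p : ℕ) * ((p : ℕ) - 2) : ℝ)) := by
  have h : Summable fun p : {p : ℕ // p.Prime ∧ 2 < p} => 3 * (1 / ((p : ℕ) : ℝ) ^ 2) :=
    ((Real.summable_one_div_nat_pow.2 one_lt_two).subtype _).mul_left 3
  refine h.of_nonneg_of_le (fun p => ?_) fun p => ?_ <;>
    have hp : (3 : ℝ) ≤ (p : ℕ) := by exact_mod_cast p.2.2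
  · exact one_div_nonneg.2 (mul_nonneg (by linarith) (by linarith))
  · rw [mul_one_div, div_le_div_iff₀ (by nlinarith) (by positivity)]
    nlinarith

theorem sum_F_le (y : ℝ) (hy : 1 ≤ y) :
    ∑ d ∈ Finset.Icc 1 ⌊y⌋₊, F d ≤
      y * ∏' p : {p : ℕ // p.Prime ∧ 2 < p},
        (1 + 1 / ((p : ℕ) * ((p : ℕ) - 2) : ℝ)) := by
  set n := ⌊y⌋₊
  have cast_gt {p : ℕ} (hp : 2 < p) : (0 : ℝ) < p - 2 := sub_pos.2 (by exact_mod_cast hp)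
  set s := (Finset.Icc 1 n).filter fun p => p.Prime ∧ 2 < p with hs
  have hF : ∀ d ∈ Finset.Icc 1 n, F d = ∏ p ∈ s.filter (· ∣ d), (1 + 1 / ((p : ℝ) - 2)) := by
    intro d hd
    rw [Finset.mem_Icc] at hd
    refine Finset.prod_congr ?_ fun p hp => ?_
    · ext p
      simp only [hs, Finset.mem_filter, Nat.mem_primeFactors, Finset.mem_Icc]
      constructor
      · rintro ⟨⟨hp, hpd, -⟩, h2⟩
        exact ⟨⟨⟨hp.one_le, (Nat.le_of_dvd hd.1 hpd).trans hd.2⟩, hp, h2⟩, hpd⟩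
      · rintro ⟨⟨-, hp, h2⟩, hpd⟩
        exact ⟨⟨hp, hpd, by lia⟩, h2⟩
    · have := cast_gt (Finset.mem_filter.1 (Finset.mem_filter.1 hp).1).2.2
      field_simp
      ring
  rw [Finset.sum_congr rfl hF]
  have one_le (p : {p : ℕ // p.Prime ∧ 2 < p}) :
      1 ≤ 1 + 1 / ((p : ℕ) * ((p : ℕ) - 2) : ℝ) := by
    have := cast_gt p.2.2
    exact le_add_of_nonneg_right (by positivity)
  have hprod : ∏ p ∈ s, (1 + 1 / ((p : ℝ) - 2) / p) ≤
      ∏' p : {p : ℕ // p.Prime ∧ 2 < p}, (1 + 1 / ((p : ℕ) * ((p : ℕ) - 2) : ℝ)) := by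
    refine le_trans (le_of_eq ?_) (prod_le_tprod_of_one_le
      (Real.multipliable_one_add_of_summable summable_one_div_mul_sub_two) one_le
      ((Finset.Icc 1 n).subtype fun p => p.Prime ∧ 2 < p))
    rw [Finset.prod_subtype_eq_prod_filter (s := Finset.Icc 1 n)
      (fun p : ℕ => 1 + 1 / ((p : ℝ) * ((p : ℝ) - 2)))]
    refine Finset.prod_congr rfl fun p _ => ?_
    rw [div_div, mul_comm]
  have hs' (p : ℕ) (hp : p ∈ s) : p.Prime ∧ 2 < p := (Finset.mem_filter.1 hp).2
  refine (sum_prod_one_add_le n s (fun p hp => (hs' p hp).1) (fun p => 1 / ((p : ℝ) - 2))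
    fun p hp => (one_div_pos.2 (cast_gt (hs' p hp).2)).le).trans ?_
  refine mul_le_mul (Nat.floor_le (zero_le_one.trans hy)) hprod
    (Finset.prod_nonneg fun p hp => ?_) (zero_le_one.trans hy)
  have := cast_gt (hs' p hp).2
  positivity
end

section
/- Let A be a primitive set such that for each a ∈ A, the pair (p(a), P(a)) of its smallest and largest prime factors is a Mertens pair, i.e., ∏_{r prime, p(a) ≤ r < P(a)} (1 − 1/r) > log p(a) / log(p(a)·P(a)). Then f(A) ≤ ∑_{p ∈ 𝒫(A)} 1/(p·log p), where 𝒫(A) is the set of primes dividing some member of A. -/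
open scoped BigOperators

/-- A set of positive integers is *primitive* if every element exceeds 1 and
no element divides another element. -/
def IsPrimitive (A : Set ℕ) : Prop :=
  (∀ a ∈ A, 1 < a) ∧ ∀ a ∈ A, ∀ b ∈ A, a ≠ b → ¬ a ∣ b

/-- `f A = ∑_{a ∈ A} 1/(a log a)`. -/
noncomputable def f (A : Set ℕ) : ℝ :=
  ∑' a : A, 1 / ((a : ℕ) * Real.log (a : ℕ))

/-- `P a`: the largest prime factor of `a` (and `0` if `a ≤ 1`). -/
def maxPrimeFac (a : ℕ) : ℕ := a.primeFactors.sup id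

/-- The support `𝒫(A)` of a set `A`: the primes dividing some member of `A`. -/
def primeSupport (A : Set ℕ) : Set ℕ :=
  {p : ℕ | p.Prime ∧ ∃ a ∈ A, p ∣ a}

/-- A pair of primes `p ≤ q` is a *Mertens pair* if
`∏_{r prime, p ≤ r < q} (1 - 1/r) > (log p)/log (pq)`. -/
def MertensPair (p q : ℕ) : Prop :=
  ∏ r ∈ (Finset.Ico p q).filter Nat.Prime, (1 - 1 / (r : ℝ)) >
    Real.log p / Real.log (p * q)

section PrimeFactors

lemma le_maxPrimeFac {a r : ℕ} (ha : a ≠ 0) (hr : r.Prime) (hra : r ∣ a) :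
    r ≤ maxPrimeFac a :=
  Finset.le_sup (f := id) (Nat.mem_primeFactors.2 ⟨hr, hra, ha⟩)

lemma maxPrimeFac_mem_primeFactors {a : ℕ} (ha : 1 < a) :
    maxPrimeFac a ∈ a.primeFactors := by
  obtain ⟨q, hq, h⟩ := Finset.exists_mem_eq_sup a.primeFactors
    (Nat.nonempty_primeFactors.2 ha) id
  rw [maxPrimeFac, h]
  exact hq

lemma minFac_le_maxPrimeFac {a : ℕ} (ha : 1 < a) : a.minFac ≤ maxPrimeFac a :=
  le_maxPrimeFac (by omega) (Nat.minFac_prime (by omega)) a.minFac_dvd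

lemma minFac_mul_maxPrimeFac_le {a : ℕ} (ha : 1 < a) (hp : ¬ a.Prime) :
    a.minFac * maxPrimeFac a ≤ a := by
  have hP := Nat.mem_primeFactors.1 (maxPrimeFac_mem_primeFactors ha)
  have hm : a.minFac.Prime := Nat.minFac_prime (by omega)
  rcases eq_or_ne a.minFac (maxPrimeFac a) with h | h
  · rw [← h, ← sq]
    exact Nat.minFac_sq_le_self (by omega) hp
  · exact Nat.le_of_dvd (by omega)
      (((Nat.coprime_primes hm hP.1).2 h).mul_dvd_of_dvd_of_dvd a.minFac_dvd hP.2.1)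

/-- If `a * b = a' * b'` where no prime factor of `b` (resp. `b'`) is smaller than the largest
prime factor of `a` (resp. `a'`), then `a` and `a'` are comparable for divisibility. -/
lemma dvd_or_dvd_of_mul_eq_mul {a a' b b' : ℕ} (ha : a ≠ 0) (ha' : a' ≠ 0) (hb : b ≠ 0)
    (hb' : b' ≠ 0) (hab : ∀ r, r.Prime → r ∣ b → maxPrimeFac a ≤ r)
    (hab' : ∀ r, r.Prime → r ∣ b' → maxPrimeFac a' ≤ r) (h : a * b = a' * b') :
    a ∣ a' ∨ a' ∣ a := by
  wlog hle : maxPrimeFac a ≤ maxPrimeFac a' generalizing a a' b b'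
  · exact (this ha' ha hb' hb hab' hab h.symm (by omega)).symm
  have hfac (r : ℕ) : a.factorization r + b.factorization r =
      a'.factorization r + b'.factorization r := by
    have := congrArg (fun n : ℕ => n.factorization r) h
    simpa [Nat.factorization_mul ha hb, Nat.factorization_mul ha' hb'] using this
  have hvb (r : ℕ) (hr : r < maxPrimeFac a) : b.factorization r = 0 := by
    by_contra hne
    have := Nat.mem_primeFactors.1 (Nat.support_factorization b ▸ Finsupp.mem_support_iff.2 hne)
    exact absurd (hab r this.1 this.2.1) (by omega)
  have hvb' (r : ℕ) (hr : r < maxPrimeFac a') : b'.factorization r = 0 := by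
    by_contra hne
    have := Nat.mem_primeFactors.1 (Nat.support_factorization b' ▸ Finsupp.mem_support_iff.2 hne)
    exact absurd (hab' r this.1 this.2.1) (by omega)
  have hva (r : ℕ) (hr : maxPrimeFac a < r) : a.factorization r = 0 := by
    by_contra hne
    have := Nat.mem_primeFactors.1 (Nat.support_factorization a ▸ Finsupp.mem_support_iff.2 hne)
    exact absurd (le_maxPrimeFac ha this.1 this.2.1) (by omega)
  have hva' (r : ℕ) (hr : maxPrimeFac a' < r) : a'.factorization r = 0 := by
    by_contra hne
    have := Nat.mem_primeFactors.1 (Nat.support_factorization a' ▸ Finsupp.mem_support_iff.2 hne)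
    exact absurd (le_maxPrimeFac ha' this.1 this.2.1) (by omega)
  rw [← Nat.factorization_le_iff_dvd ha ha', ← Nat.factorization_le_iff_dvd ha' ha]
  by_cases hc : maxPrimeFac a < maxPrimeFac a' ∨
      a.factorization (maxPrimeFac a) ≤ a'.factorization (maxPrimeFac a)
  · left
    intro r
    have := hfac r
    have := hvb r
    have := hvb' r
    have := hva r
    rcases lt_trichotomy r (maxPrimeFac a) with hr | rfl | hr <;> omega
  · right
    intro r
    have := hfac r
    have := hvb r
    have := hvb' r
    have := hva' r
    rcases lt_trichotomy r (maxPrimeFac a) with hr | rfl | hr <;> omega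

end PrimeFactors

section EulerFactors

/-- The product of `1 - 1/r` over the primes `r` with `x ≤ r < y`. -/
noncomputable def eulerFactor (x y : ℕ) : ℝ :=
  ∏ r ∈ (Finset.Ico x y).filter Nat.Prime, (1 - 1 / (r : ℝ))

lemma eulerFactor_pos (x y : ℕ) : 0 < eulerFactor x y := by
  refine Finset.prod_pos fun r hr => ?_
  have : (1 : ℝ) < r := by exact_mod_cast (Finset.mem_filter.1 hr).2.one_lt
  rw [sub_pos, div_lt_one (by linarith)]
  exact this

lemma eulerFactor_mul {x y z : ℕ} (hxy : x ≤ y) (hyz : y ≤ z) :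
    eulerFactor x y * eulerFactor y z = eulerFactor x z := by
  simp only [eulerFactor, Finset.prod_filter]
  exact Finset.prod_Ico_consecutive _ hxy hyz

lemma hasSum_inv_factoredNumbers (x y : ℕ) :
    HasSum (fun m : Nat.factoredNumbers (Finset.Ico x y) => ((m : ℕ) : ℝ)⁻¹)
      (eulerFactor x y)⁻¹ := by
  let φ : ℕ →* ℝ :=
    { toFun := fun n => (n : ℝ)⁻¹
      map_one' := by simp
      map_mul' := fun m n => by push_cast; rw [mul_inv] }
  have h := (EulerProduct.summable_and_hasSum_factoredNumbers_prod_filter_prime_geometric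
    (f := φ) (fun {p} hp => by
      have : (1 : ℝ) < p := by exact_mod_cast hp.one_lt
      change ‖(p : ℝ)⁻¹‖ < 1
      rw [norm_inv, Real.norm_natCast]
      exact inv_lt_one_of_one_lt₀ this) (Finset.Ico x y)).2
  rw [Finset.prod_inv_distrib] at h
  simpa [eulerFactor, φ] using h

end EulerFactors

/-- A Kraft-type inequality for primitive sets whose members share the least prime factor `p`. -/
lemma sum_inv_mul_eulerFactor_le {p : ℕ} (F : Finset ℕ)
    (hF : IsPrimitive (F : Set ℕ)) (hmin : ∀ a ∈ F, a.minFac = p) :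
    ∑ a ∈ F, (a : ℝ)⁻¹ * eulerFactor p (maxPrimeFac a) ≤ (p : ℝ)⁻¹ := by
  obtain ⟨N, hN⟩ : ∃ N, ∀ a ∈ F, maxPrimeFac a < N :=
    ⟨F.sup maxPrimeFac + 1, fun a ha => Nat.lt_succ_of_le (Finset.le_sup ha)⟩
  have h1 (a : F) : 1 < (a : ℕ) := hF.1 a a.2
  have hple (a : F) : p ≤ maxPrimeFac a := hmin a a.2 ▸ minFac_le_maxPrimeFac (h1 a)
  have hpd (a : F) : p ∣ a := hmin a a.2 ▸ (a : ℕ).minFac_dvd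
  let e : (Σ a : F, Nat.factoredNumbers (Finset.Ico (maxPrimeFac a) N)) →
      Nat.factoredNumbers (Finset.Ico p N) := fun x => ⟨x.1 / p * x.2, by
    rw [Nat.mem_factoredNumbers']
    intro r hr hrd
    rcases hr.dvd_mul.1 hrd with h | h
    · have hra : r ∣ x.1 := h.trans (Nat.div_dvd_of_dvd (hpd x.1))
      have := le_maxPrimeFac (by have := h1 x.1; omega) hr hra
      have := hN x.1 x.1.2
      have := hmin x.1 x.1.2 ▸ Nat.minFac_le_of_dvd hr.two_le hra
      rw [Finset.mem_Ico]
      omega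
    · have := Finset.mem_Ico.1 (Nat.mem_factoredNumbers'.1 x.2.2 r hr h)
      have := hple x.1
      rw [Finset.mem_Ico]
      omega⟩
  have hpe (x) : p * (e x : ℕ) = x.1 * x.2 := by
    change p * (x.1 / p * x.2) = _
    rw [← mul_assoc, Nat.mul_div_cancel' (hpd x.1)]
  have he : Function.Injective e := by
    rintro ⟨a, b⟩ ⟨a', b'⟩ hx
    have hmul : (a : ℕ) * b = a' * b' := by
      rw [← hpe ⟨a, b⟩, hx, hpe]
    have haa : a = a' := by
      by_contra hne
      have hne' : (a : ℕ) ≠ a' := fun h => hne (Subtype.ext h)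
      rcases dvd_or_dvd_of_mul_eq_mul (by have := h1 a; omega) (by have := h1 a'; omega)
        (Nat.ne_zero_of_mem_factoredNumbers b.2) (Nat.ne_zero_of_mem_factoredNumbers b'.2)
        (fun r hr h => (Finset.mem_Ico.1 (Nat.mem_factoredNumbers'.1 b.2 r hr h)).1)
        (fun r hr h => (Finset.mem_Ico.1 (Nat.mem_factoredNumbers'.1 b'.2 r hr h)).1) hmul with h | h
      · exact hF.2 a a.2 a' a'.2 hne' h
      · exact hF.2 a' a'.2 a a.2 hne'.symm h
    subst haa
    have hbb : b = b' := Subtype.ext (Nat.eq_of_mul_eq_mul_left (by have := h1 a; omega) hmul)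
    rw [hbb]
  have hg := (hasSum_inv_factoredNumbers p N).mul_left (p : ℝ)⁻¹
  have hge : ∀ x, (p : ℝ)⁻¹ * ((e x : ℕ) : ℝ)⁻¹ = ((x.1 : ℕ) : ℝ)⁻¹ * ((x.2 : ℕ) : ℝ)⁻¹ := by
    intro x
    rw [← mul_inv, ← mul_inv]
    exact_mod_cast congrArg (fun n : ℕ => (n : ℝ)⁻¹) (hpe x)
  have hsum := hg.summable.comp_injective he
  have hle := tsum_comp_le_tsum_of_inj hg.summable (fun m => by positivity) he
  rw [hg.tsum_eq] at hle
  simp only [Function.comp_def, hge] at hsum hle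
  rw [hsum.tsum_sigma, tsum_fintype] at hle
  simp only [tsum_mul_left, (hasSum_inv_factoredNumbers _ _).tsum_eq] at hle
  rw [Finset.sum_coe_sort F
    (fun a => (a : ℝ)⁻¹ * (eulerFactor (maxPrimeFac a) N)⁻¹)] at hle
  have hpos := eulerFactor_pos p N
  calc ∑ a ∈ F, (a : ℝ)⁻¹ * eulerFactor p (maxPrimeFac a)
      = (∑ a ∈ F, (a : ℝ)⁻¹ * (eulerFactor (maxPrimeFac a) N)⁻¹) * eulerFactor p N := by
        rw [Finset.sum_mul]
        refine Finset.sum_congr rfl fun a ha => ?_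
        rw [← eulerFactor_mul (hple ⟨a, ha⟩) (hN a ha).le]
        have := (eulerFactor_pos (maxPrimeFac a) N).ne'
        field_simp
    _ ≤ (p : ℝ)⁻¹ * (eulerFactor p N)⁻¹ * eulerFactor p N := by gcongr
    _ = (p : ℝ)⁻¹ := by field_simp

lemma sum_one_div_mul_log_le_of_minFac_eq {p : ℕ} (hp : p.Prime) (F : Finset ℕ)
    (hF : IsPrimitive (F : Set ℕ)) (hmin : ∀ a ∈ F, a.minFac = p)
    (hMP : ∀ a ∈ F, MertensPair a.minFac (maxPrimeFac a)) :
    ∑ a ∈ F, 1 / ((a : ℝ) * Real.log a) ≤ 1 / ((p : ℝ) * Real.log p) := by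
  by_cases hpF : p ∈ F
  · have : F = {p} := by
      refine Finset.eq_singleton_iff_unique_mem.2 ⟨hpF, fun a ha => ?_⟩
      by_contra hne
      exact hF.2 p hpF a ha (Ne.symm hne) (hmin a ha ▸ a.minFac_dvd)
    simp [this]
  have hlogp : 0 < Real.log p := Real.log_pos (by exact_mod_cast hp.one_lt)
  calc ∑ a ∈ F, 1 / ((a : ℝ) * Real.log a)
      ≤ ∑ a ∈ F, ((a : ℝ)⁻¹ * eulerFactor p (maxPrimeFac a)) * (Real.log p)⁻¹ := by
        refine Finset.sum_le_sum fun a ha => ?_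
        have ha1 : 1 < a := hF.1 a ha
        have hnp : ¬ a.Prime := fun h => hpF (by rwa [← hmin a ha, h.minFac_eq])
        have hle := minFac_mul_maxPrimeFac_le ha1 hnp
        have hP := (Nat.mem_primeFactors.1 (maxPrimeFac_mem_primeFactors ha1)).1
        have hm := hMP a ha
        rw [hmin a ha] at hle hm
        have hpP : (1 : ℝ) < p * maxPrimeFac a := by
          exact_mod_cast Nat.one_lt_mul_iff.2 ⟨hp.pos, hP.pos, Or.inl hp.one_lt⟩
        have hlog : Real.log (p * maxPrimeFac a) ≤ Real.log a :=
          Real.log_le_log (by linarith) (by exact_mod_cast hle)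
        have hlogpos : 0 < Real.log (p * maxPrimeFac a) := Real.log_pos hpP
        have ha0 : (0 : ℝ) < a := by positivity
        have key : (Real.log a)⁻¹ ≤ eulerFactor p (maxPrimeFac a) * (Real.log p)⁻¹ := by
          rw [← div_eq_mul_inv, le_div_iff₀ hlogp]
          calc (Real.log a)⁻¹ * Real.log p
              ≤ (Real.log (p * maxPrimeFac a))⁻¹ * Real.log p := by gcongr
            _ = Real.log p / Real.log (p * maxPrimeFac a) := by ring
            _ ≤ _ := le_of_lt hm
        rw [one_div, mul_inv, mul_assoc]
        gcongr
    _ = (∑ a ∈ F, (a : ℝ)⁻¹ * eulerFactor p (maxPrimeFac a)) * (Real.log p)⁻¹ :=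
        (Finset.sum_mul ..).symm
    _ ≤ (p : ℝ)⁻¹ * (Real.log p)⁻¹ := by
        gcongr
        exact sum_inv_mul_eulerFactor_le F hF hmin
    _ = _ := by rw [one_div, mul_inv]

lemma sum_one_div_mul_log_dyadic_le {k : ℕ} (hk : k ≠ 0) (F : Finset ℕ)
    (hF : ∀ p ∈ F, p.Prime ∧ Nat.log 2 p = k) :
    ∑ p ∈ F, 1 / ((p : ℝ) * Real.log p) ≤
      2 * Real.log 4 / Real.log 2 ^ 2 * (1 / (k : ℝ) ^ 2) := by
  have hl2 : 0 < Real.log 2 := Real.log_pos (by norm_num)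
  have hk0 : (0 : ℝ) < k := by positivity
  set c : ℝ := 1 / (2 ^ k * (k * Real.log 2) ^ 2) with hc
  have hterm : ∀ p ∈ F, 1 / ((p : ℝ) * Real.log p) ≤ c * Real.log p := by
    intro p hp
    obtain ⟨hpp, hpk⟩ := hF p hp
    have h2 : (2 : ℝ) ^ k ≤ p := by
      exact_mod_cast hpk ▸ Nat.pow_log_le_self 2 hpp.ne_zero
    have hlog : k * Real.log 2 ≤ Real.log p := by
      rw [← Real.log_pow]
      exact Real.log_le_log (by positivity) h2
    have hlp : 0 < Real.log p := lt_of_lt_of_le (by positivity) hlog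
    calc 1 / ((p : ℝ) * Real.log p) = 1 / (p * Real.log p ^ 2) * Real.log p := by
          field_simp
      _ ≤ c * Real.log p := by rw [hc]; gcongr
  have htheta : ∑ p ∈ F, Real.log p ≤ Real.log 4 * 2 ^ (k + 1) := by
    have h := Chebyshev.theta_le_log4_mul_x (x := (2 : ℝ) ^ (k + 1)) (by positivity)
    refine le_trans ?_ h
    rw [show (2 : ℝ) ^ (k + 1) = ((2 ^ (k + 1) : ℕ) : ℝ) by push_cast; rfl,
      Chebyshev.theta_eq_sum_primesLE_log]
    refine Finset.sum_le_sum_of_subset_of_nonneg (fun p hp => ?_) fun p _ _ =>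
      Real.log_natCast_nonneg p
    obtain ⟨hpp, hpk⟩ := hF p hp
    have := hpk ▸ Nat.lt_pow_succ_log_self one_lt_two p
    exact Nat.mem_primesLE.2 ⟨this.le, hpp⟩
  calc ∑ p ∈ F, 1 / ((p : ℝ) * Real.log p) ≤ ∑ p ∈ F, c * Real.log p := Finset.sum_le_sum hterm
    _ = c * ∑ p ∈ F, Real.log p := (Finset.mul_sum ..).symm
    _ ≤ c * (Real.log 4 * 2 ^ (k + 1)) := by gcongr
    _ = _ := by rw [hc]; field_simp; ring

lemma summable_one_div_mul_log_primes :
    Summable fun p : {p : ℕ // p.Prime} => 1 / ((p : ℝ) * Real.log p) := by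
  have hs : Summable fun k : ℕ => 2 * Real.log 4 / Real.log 2 ^ 2 * (1 / (k : ℝ) ^ 2) :=
    (Real.summable_one_div_nat_pow.2 one_lt_two).mul_left _
  have hnn (k : ℕ) : 0 ≤ 2 * Real.log 4 / Real.log 2 ^ 2 * (1 / (k : ℝ) ^ 2) := by
    have := Real.log_nonneg (show (1 : ℝ) ≤ 4 by norm_num)
    positivity
  refine summable_of_sum_le (c := ∑' k : ℕ, 2 * Real.log 4 / Real.log 2 ^ 2 * (1 / (k : ℝ) ^ 2))
    (fun p => ?_) fun u => ?_
  · have := Real.log_natCast_nonneg (p : ℕ)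
    positivity
  · rw [← Finset.sum_fiberwise_of_maps_to (s := u)
      (t := u.image fun p : {p : ℕ // p.Prime} => Nat.log 2 p)
      (g := fun p => Nat.log 2 p) (fun p hp => Finset.mem_image_of_mem _ hp)]
    refine le_trans (Finset.sum_le_sum fun k hk => ?_) (hs.sum_le_tsum _ fun k _ => hnn k)
    obtain ⟨q, _, rfl⟩ := Finset.mem_image.1 hk
    have := sum_one_div_mul_log_dyadic_le (Nat.log_pos one_lt_two q.2.two_le).ne'
      ((u.filter fun p : {p : ℕ // p.Prime} => Nat.log 2 p = Nat.log 2 q).map (Function.Embedding.subtype _))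
      (by
        intro p hp
        obtain ⟨x, hx, rfl⟩ := Finset.mem_map.1 hp
        exact ⟨x.2, (Finset.mem_filter.1 hx).2⟩)
    rwa [Finset.sum_map] at this

theorem mertens_pair_support (A : Set ℕ) (hA : IsPrimitive A)
    (hMP : ∀ a ∈ A, MertensPair a.minFac (maxPrimeFac a)) :
    f A ≤ ∑' p : primeSupport A, 1 / ((p : ℕ) * Real.log (p : ℕ)) := by
  have hnn (n : ℕ) : 0 ≤ 1 / ((n : ℝ) * Real.log n) := by
    have := Real.log_natCast_nonneg n
    positivity
  have hs : Summable fun p : primeSupport A => 1 / ((p : ℝ) * Real.log p) :=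
    summable_one_div_mul_log_primes.comp_injective
      (i := fun p : primeSupport A => (⟨p, p.2.1⟩ : {p : ℕ // p.Prime}))
      fun p q h => Subtype.ext (congrArg (fun x : {p : ℕ // p.Prime} => (x : ℕ)) h)
  have hprime (a : A) : (a : ℕ).minFac ∈ primeSupport A :=
    ⟨Nat.minFac_prime (hA.1 a a.2).ne', a, a.2, (a : ℕ).minFac_dvd⟩
  let m : A → primeSupport A := fun a => ⟨(a : ℕ).minFac, hprime a⟩
  refine tsum_le_of_sum_le' (tsum_nonneg fun p => hnn p) fun u => ?_
  classical
  rw [← Finset.sum_fiberwise_of_maps_to (s := u) (t := u.image m) (g := m)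
    (fun a ha => Finset.mem_image_of_mem _ ha)]
  refine le_trans (Finset.sum_le_sum fun p _ => ?_) (hs.sum_le_tsum _ fun p _ => hnn p)
  have hmem : ∀ a ∈ (u.filter fun a => m a = p).map (Function.Embedding.subtype _),
      a ∈ A ∧ a.minFac = p := by
    intro a ha
    obtain ⟨x, hx, rfl⟩ := Finset.mem_map.1 ha
    exact ⟨x.2, congrArg Subtype.val (Finset.mem_filter.1 hx).2⟩
  have := sum_one_div_mul_log_le_of_minFac_eq p.2.1
    ((u.filter fun a => m a = p).map (Function.Embedding.subtype _))
    ⟨fun a ha => hA.1 a (hmem a ha).1, fun a ha b hb => hA.2 a (hmem a ha).1 b (hmem b hb).1⟩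
    (fun a ha => (hmem a ha).2) (fun a ha => hMP a (hmem a ha).1)
  rwa [Finset.sum_map] at this
end

section
/- Let Q be a set of Zhang primes, i.e., each q ∈ Q satisfies ∑_{r prime, r ≥ q} 1/(r·log r) ≤ 1/log q. For k ≥ 1 let ℕ_k(Q) be the set of integers n with exactly k prime factors counted with multiplicity, all of whose prime factors lie in Q. Then h(ℕ_k(Q)) ≥ h(ℕ_{k+1}(Q)) for all k ≥ 1, where h(S) = ∑_{a∈S} 1/(a·log P(a)) and P(a) is the largest prime factor of a. -/
open scoped BigOperators

/-- A prime `q` is *Zhang* if `∑_{r prime, r ≥ q} 1/(r log r) ≤ 1/log q`. -/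
def IsZhang (q : ℕ) : Prop :=
  ∑' r : {r : ℕ // r.Prime ∧ q ≤ r}, 1 / ((r : ℕ) * Real.log (r : ℕ)) ≤
    1 / Real.log q

/-- `h S = ∑_{a ∈ S} 1/(a log P(a))`. -/
noncomputable def h (S : Set ℕ) : ℝ :=
  ∑' a : S, 1 / ((a : ℕ) * Real.log (maxPrimeFac a))

/-- `ℕ_k(Q)`: integers with exactly `k` prime factors counted with
multiplicity, all of whose prime factors lie in `Q`. -/
def NNQ (k : ℕ) (Q : Set ℕ) : Set ℕ :=
  {n : ℕ | (Nat.primeFactorsList n).length = k ∧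
    ∀ p : ℕ, p.Prime → p ∣ n → p ∈ Q}

open scoped ENNReal

lemma sum_primes_dyadic_le (j : ℕ) :
    ∑ p ∈ (Finset.Ico (2 ^ j) (2 ^ (j + 1))).filter Nat.Prime, 1 / ((p : ℝ) * Real.log p) ≤
      4 / Real.log 2 * (1 / (j : ℝ) ^ 2) := by
  have hlog2 : 0 < Real.log 2 := Real.log_pos one_lt_two
  rcases Nat.eq_zero_or_pos j with rfl | hj
  · have hempty : (Finset.Ico (2 ^ 0) (2 ^ (0 + 1))).filter Nat.Prime = ∅ := by decide
    rw [hempty]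
    simp
  have hj' : (0 : ℝ) < j := by exact_mod_cast hj
  have hpow : (0 : ℝ) < 2 ^ j := by positivity
  have hterm : ∀ p ∈ (Finset.Ico (2 ^ j) (2 ^ (j + 1))).filter Nat.Prime,
      1 / ((p : ℝ) * Real.log p) ≤ Real.log p / (2 ^ j * (j * Real.log 2) ^ 2) := by
    intro p hp
    have hle : (2 : ℝ) ^ j ≤ p := by
      exact_mod_cast (Finset.mem_Ico.mp (Finset.mem_filter.mp hp).1).1
    have hl : j * Real.log 2 ≤ Real.log p := by
      rw [← Real.log_pow]
      exact Real.log_le_log hpow hle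
    have hc : 0 < j * Real.log 2 := by positivity
    have hlp : 0 < Real.log p := hc.trans_le hl
    have hp0 : (0 : ℝ) < p := hpow.trans_le hle
    rw [div_le_div_iff₀ (by positivity) (by positivity)]
    calc 1 * (2 ^ j * (j * Real.log 2) ^ 2) ≤ p * Real.log p ^ 2 := by
          rw [one_mul]
          gcongr
      _ = Real.log p * (p * Real.log p) := by ring
  have htheta : ∑ p ∈ (Finset.Ico (2 ^ j) (2 ^ (j + 1))).filter Nat.Prime, Real.log p ≤
      Chebyshev.theta ((2 ^ (j + 1) : ℕ) : ℝ) := by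
    rw [Chebyshev.theta_eq_sum_primesLE_log]
    refine Finset.sum_le_sum_of_subset_of_nonneg ?_ fun p _ _ => Real.log_natCast_nonneg p
    intro p hp
    simp only [Finset.mem_filter, Finset.mem_Ico] at hp
    simpa [Nat.mem_primesLE] using ⟨hp.1.2.le, hp.2⟩
  have hcheb := Chebyshev.theta_le_log4_mul_x (x := ((2 ^ (j + 1) : ℕ) : ℝ)) (by positivity)
  have hlog4 : Real.log 4 = 2 * Real.log 2 := by
    rw [show (4 : ℝ) = 2 ^ 2 by norm_num, Real.log_pow]
    norm_num
  calc _ ≤ ∑ p ∈ (Finset.Ico (2 ^ j) (2 ^ (j + 1))).filter Nat.Prime,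
        Real.log p / (2 ^ j * (j * Real.log 2) ^ 2) := Finset.sum_le_sum hterm
    _ ≤ (Real.log 4 * ((2 ^ (j + 1) : ℕ) : ℝ)) / (2 ^ j * (j * Real.log 2) ^ 2) := by
        rw [← Finset.sum_div]
        gcongr
        exact htheta.trans hcheb
    _ = 4 / Real.log 2 * (1 / (j : ℝ) ^ 2) := by
        rw [hlog4]
        push_cast
        field_simp
        ring

lemma summable_primes_one_div_mul_log :
    Summable fun p : {p : ℕ // p.Prime} => 1 / ((p : ℕ) * Real.log (p : ℕ)) := by
  set f : ℕ → ℝ := fun p => 1 / ((p : ℝ) * Real.log p) with hf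
  have hf0 : ∀ p, 0 ≤ f p := fun p => by
    have := Real.log_natCast_nonneg p
    positivity
  refine (summable_subtype_iff_indicator (f := f) (s := {p | p.Prime})).mpr ?_
  have hg0 : ∀ p, 0 ≤ Set.indicator {p : ℕ | p.Prime} f p :=
    fun p => Set.indicator_nonneg (fun p _ => hf0 p) p
  have hs : Summable fun j : ℕ => 4 / Real.log 2 * (1 / (j : ℝ) ^ 2) :=
    (Real.summable_one_div_nat_pow.mpr one_lt_two).mul_left _
  have hpart : ∀ n : ℕ, ∑ p ∈ Finset.range (2 ^ n), Set.indicator {p : ℕ | p.Prime} f p ≤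
      ∑ j ∈ Finset.range n, 4 / Real.log 2 * (1 / (j : ℝ) ^ 2) := by
    intro n
    induction n with
    | zero => simp [Nat.not_prime_zero]
    | succ n ih =>
      rw [← Finset.sum_range_add_sum_Ico _ (Nat.pow_le_pow_right two_pos n.le_succ),
        Finset.sum_range_succ]
      refine add_le_add ih ((le_of_eq ?_).trans (sum_primes_dyadic_le n))
      rw [Finset.sum_filter]
      exact Finset.sum_congr rfl fun p _ => by simp [Set.indicator_apply, hf]
  refine summable_of_sum_range_le (c := ∑' j : ℕ, 4 / Real.log 2 * (1 / (j : ℝ) ^ 2)) hg0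
    fun n => ?_
  refine (Finset.sum_le_sum_of_subset_of_nonneg
    (Finset.range_mono (Nat.lt_two_pow_self (n := n)).le) fun p _ _ => hg0 p).trans
    ((hpart n).trans (hs.sum_le_tsum _ fun j _ => ?_))
  have := Real.log_pos one_lt_two
  positivity

/-- The `ℝ≥0∞`-valued version of `h`. -/
noncomputable def hENN (S : Set ℕ) : ℝ≥0∞ :=
  ∑' a : S, ENNReal.ofReal (1 / ((a : ℕ) * Real.log (maxPrimeFac a)))

lemma one_div_mul_log_nonneg (a b : ℕ) : 0 ≤ 1 / ((a : ℝ) * Real.log b) := by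
  have := Real.log_natCast_nonneg b
  positivity

lemma toReal_hENN (S : Set ℕ) : (hENN S).toReal = h S := by
  rw [hENN, ENNReal.tsum_toReal_eq fun _ => ENNReal.ofReal_ne_top]
  exact tsum_congr fun a => ENNReal.toReal_ofReal (one_div_mul_log_nonneg _ _)

lemma IsZhang.tsum_ofReal_le {q : ℕ} (hq : IsZhang q) :
    ∑' r : {r : ℕ // r.Prime ∧ q ≤ r}, ENNReal.ofReal (1 / ((r : ℕ) * Real.log (r : ℕ))) ≤
      ENNReal.ofReal (1 / Real.log q) := by
  have hinj : Function.Injective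
      fun r : {r : ℕ // r.Prime ∧ q ≤ r} => (⟨r.1, r.2.1⟩ : {p : ℕ // p.Prime}) :=
    fun r s hrs => Subtype.ext (congrArg (fun x : {p : ℕ // p.Prime} => (x : ℕ)) hrs)
  rw [← ENNReal.ofReal_tsum_of_nonneg (fun r => one_div_mul_log_nonneg _ _)
    (summable_primes_one_div_mul_log.comp_injective hinj)]
  exact ENNReal.ofReal_le_ofReal hq

lemma maxPrimeFac_mem_primeFactors_s18 {n : ℕ} (hn : n.primeFactors.Nonempty) :
    maxPrimeFac n ∈ n.primeFactors := by
  obtain ⟨p, hp, hpe⟩ := Finset.exists_mem_eq_sup _ hn id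
  rw [maxPrimeFac, hpe]
  exact hp

lemma NNQ_ne_zero {k : ℕ} {Q : Set ℕ} (hk : 1 ≤ k) {n : ℕ} (hn : n ∈ NNQ k Q) : n ≠ 0 := by
  rintro rfl
  have := hn.1
  simp at this
  omega

lemma NNQ_maxPrimeFac_mem {k : ℕ} {Q : Set ℕ} (hk : 1 ≤ k) {n : ℕ} (hn : n ∈ NNQ k Q) :
    maxPrimeFac n ∈ n.primeFactors := by
  refine maxPrimeFac_mem_primeFactors_s18 (Nat.nonempty_primeFactors.mpr ?_)
  by_contra hlt
  have h1 : n = 0 ∨ n = 1 := by omega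
  have := hn.1
  rcases h1 with rfl | rfl <;> simp at this <;> omega

lemma NNQ_div_maxPrimeFac_mem {k : ℕ} {Q : Set ℕ} {n : ℕ} (hn : n ∈ NNQ (k + 1) Q) :
    n / maxPrimeFac n ∈ NNQ k Q := by
  have hmem := NNQ_maxPrimeFac_mem (Nat.le_add_left 1 k) hn
  have hp := Nat.prime_of_mem_primeFactors hmem
  obtain ⟨m, hm⟩ := Nat.dvd_of_mem_primeFactors hmem
  have hn0 := NNQ_ne_zero (Nat.le_add_left 1 k) hn
  have hdiv : n / maxPrimeFac n = m := by
    conv_lhs => enter [1]; rw [hm]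
    exact Nat.mul_div_cancel_left m hp.pos
  rw [hdiv]
  have hm0 : m ≠ 0 := by
    rintro rfl
    exact hn0 (by simpa using hm)
  refine ⟨?_, fun q hq hqm => hn.2 q hq (hm ▸ hqm.mul_left _)⟩
  have hlen := hn.1
  rw [hm, (Nat.perm_primeFactorsList_mul hp.ne_zero hm0).length_eq, List.length_append,
    Nat.primeFactorsList_prime hp, List.length_singleton] at hlen
  omega

lemma hENN_NNQ_succ_le {Q : Set ℕ} (hQ : ∀ q ∈ Q, Nat.Prime q ∧ IsZhang q)
    {k : ℕ} (hk : 1 ≤ k) : hENN (NNQ (k + 1) Q) ≤ hENN (NNQ k Q) := by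
  have hmem (n : NNQ (k + 1) Q) := NNQ_maxPrimeFac_mem (Nat.le_add_left 1 k) n.2
  have hmono (n : NNQ (k + 1) Q) : maxPrimeFac (n / maxPrimeFac n) ≤ maxPrimeFac n :=
    Finset.sup_mono (Nat.primeFactors_mono (Nat.div_dvd_of_dvd (Nat.dvd_of_mem_primeFactors (hmem n)))
      (NNQ_ne_zero (Nat.le_add_left 1 k) n.2))
  let φ : NNQ (k + 1) Q → Σ a : NNQ k Q, {r : ℕ // r.Prime ∧ maxPrimeFac a ≤ r} := fun n =>
    ⟨⟨n / maxPrimeFac n, NNQ_div_maxPrimeFac_mem n.2⟩,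
      ⟨maxPrimeFac n, Nat.prime_of_mem_primeFactors (hmem n), hmono n⟩⟩
  let g : (Σ a : NNQ k Q, {r : ℕ // r.Prime ∧ maxPrimeFac a ≤ r}) → ℝ≥0∞ := fun x =>
    ENNReal.ofReal (1 / (x.1 : ℕ)) *
      ENNReal.ofReal (1 / ((x.2 : ℕ) * Real.log (x.2 : ℕ)))
  have hmul (n : NNQ (k + 1) Q) : (n : ℕ) / maxPrimeFac n * maxPrimeFac n = n :=
    Nat.div_mul_cancel (Nat.dvd_of_mem_primeFactors (hmem n))
  have hφ : Function.Injective φ := by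
    intro n m hnm
    have hval := congrArg (fun x : (Σ a : NNQ k Q, {r : ℕ // r.Prime ∧ maxPrimeFac a ≤ r}) =>
      (x.1 : ℕ) * (x.2 : ℕ)) hnm
    exact Subtype.ext (((hmul n).symm.trans hval).trans (hmul m))
  calc hENN (NNQ (k + 1) Q) = ∑' n, g (φ n) := by
        refine tsum_congr fun n => ?_
        simp only [g, φ]
        rw [← ENNReal.ofReal_mul (by positivity), one_div_mul_one_div, ← mul_assoc]
        congr 3
        exact_mod_cast (hmul n).symm
    _ ≤ ∑' x, g x := ENNReal.tsum_comp_le_tsum_of_injective hφ g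
    _ = ∑' a : NNQ k Q, ENNReal.ofReal (1 / (a : ℕ)) *
          ∑' r : {r : ℕ // r.Prime ∧ maxPrimeFac a ≤ r},
            ENNReal.ofReal (1 / ((r : ℕ) * Real.log (r : ℕ))) := by
        rw [ENNReal.tsum_sigma']
        refine tsum_congr fun a => ?_
        simp only [g]
        rw [ENNReal.tsum_mul_left]
    _ ≤ hENN (NNQ k Q) := by
        refine ENNReal.tsum_le_tsum fun a => ?_
        have ha := NNQ_maxPrimeFac_mem hk a.2
        have hz := (hQ _ (a.2.2 _ (Nat.prime_of_mem_primeFactors ha)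
          (Nat.dvd_of_mem_primeFactors ha))).2
        refine (mul_le_mul_right hz.tsum_ofReal_le _).trans (le_of_eq ?_)
        rw [← ENNReal.ofReal_mul (by positivity), one_div_mul_one_div]

lemma hENN_NNQ_one_ne_top (Q : Set ℕ) : hENN (NNQ 1 Q) ≠ ⊤ := by
  have hprime (n : NNQ 1 Q) : (n : ℕ).Prime := by
    obtain ⟨p, hp⟩ := List.length_eq_one_iff.mp n.2.1
    have hpp : p.Prime := Nat.prime_of_mem_primeFactorsList (n := n) (by simp [hp])
    have := Nat.prod_primeFactorsList (NNQ_ne_zero le_rfl n.2)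
    rw [hp, List.prod_singleton] at this
    rwa [← this]
  have hinj : Function.Injective fun n : NNQ 1 Q => (⟨n, hprime n⟩ : {p : ℕ // p.Prime}) :=
    fun n m hnm => Subtype.ext (congrArg (fun x : {p : ℕ // p.Prime} => (x : ℕ)) hnm)
  have hs := summable_primes_one_div_mul_log.comp_injective hinj
  have heq : hENN (NNQ 1 Q) =
      ∑' n : NNQ 1 Q, ENNReal.ofReal (1 / ((n : ℕ) * Real.log (n : ℕ))) :=
    tsum_congr fun n => by simp [maxPrimeFac, (hprime n).primeFactors]
  rw [heq, ← ENNReal.ofReal_tsum_of_nonneg (fun n => one_div_mul_log_nonneg _ _) hs]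
  exact ENNReal.ofReal_ne_top

lemma hENN_NNQ_ne_top {Q : Set ℕ} (hQ : ∀ q ∈ Q, Nat.Prime q ∧ IsZhang q)
    {k : ℕ} (hk : 1 ≤ k) : hENN (NNQ k Q) ≠ ⊤ := by
  induction k, hk using Nat.le_induction with
  | base => exact hENN_NNQ_one_ne_top Q
  | succ k hk ih => exact ne_top_of_le_ne_top ih (hENN_NNQ_succ_le hQ hk)

theorem h_NNQ_antitone (Q : Set ℕ) (hQ : ∀ q ∈ Q, Nat.Prime q ∧ IsZhang q)
    (k : ℕ) (hk : 1 ≤ k) :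
    h (NNQ (k + 1) Q) ≤ h (NNQ k Q) := by
  rw [← toReal_hENN, ← toReal_hENN]
  exact ENNReal.toReal_mono (hENN_NNQ_ne_top hQ hk) (hENN_NNQ_succ_le hQ hk)
end

section
/- There is a constant c > 0 such that for every real x there exists a primitive set A contained in [x, ∞) with f(A) ≥ c; equivalently, limsup_{x→∞} sup{f(A) : A ⊆ [x,∞), A primitive} > 0. -/
open scoped BigOperators

lemma multiset_eq_of_prod_dvd_prod {m m' : Multiset ℕ} (h : ∀ p ∈ m, p.Prime)
    (h' : ∀ p ∈ m', p.Prime)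
    (hc : m'.card ≤ m.card) (hd : m.prod ∣ m'.prod) : m = m' := by
  have hm : m.prod ≠ 0 := Multiset.prod_ne_zero fun h0 => (h 0 h0).ne_zero rfl
  have hm' : m'.prod ≠ 0 := Multiset.prod_ne_zero fun h0 => (h' 0 h0).ne_zero rfl
  rw [UniqueFactorizationMonoid.dvd_iff_normalizedFactors_le_normalizedFactors hm hm',
    UniqueFactorizationMonoid.normalizedFactors_prod_of_prime fun p hp => (h p hp).prime,
    UniqueFactorizationMonoid.normalizedFactors_prod_of_prime fun p hp => (h' p hp).prime] at hd
  exact Multiset.eq_of_le_of_card_le hd hc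

lemma integral_exp_mul_exp_le {L C T : ℝ} (hL : 0 < L) :
    ∫ t in (0:ℝ)..T, Real.exp (-C - t) * Real.exp (-(L * Real.exp (-C - t))) ≤ 1 / L := by
  have hder : ∀ t : ℝ, HasDerivAt (fun t => Real.exp (-(L * Real.exp (-C - t))) / L)
      (Real.exp (-C - t) * Real.exp (-(L * Real.exp (-C - t)))) t := by
    intro t
    have h1 : HasDerivAt (fun t : ℝ => -C - t) (-1) t := by
      simpa using (hasDerivAt_id t).const_sub (-C)
    convert! (((h1.exp.const_mul L).neg).exp).div_const L using 1
    simp only [Pi.neg_apply]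
    rw [eq_div_iff hL.ne']
    ring
  rw [intervalIntegral.integral_eq_sub_of_hasDerivAt (fun t _ => hder t)
    (Continuous.intervalIntegrable (by fun_prop) _ _)]
  have h1 : Real.exp (-(L * Real.exp (-C - T))) ≤ 1 :=
    Real.exp_le_one_iff.2 (by have := Real.exp_pos (-C - T); nlinarith)
  have h2 : 0 ≤ Real.exp (-(L * Real.exp (-C - 0))) / L := by positivity
  have := div_le_div_of_nonneg_right h1 hL.le
  linarith

lemma exists_half_le_integral_gamma (k : ℕ) : ∃ T : ℝ, 0 ≤ T ∧
    (1 / 2 : ℝ) ≤ ∫ t in (0:ℝ)..T, Real.exp (-t) * (t ^ k / k.factorial) := by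
  have hk : (0:ℝ) < k + 1 := by positivity
  have h1 := MeasureTheory.intervalIntegral_tendsto_integral_Ioi 0
    (Real.GammaIntegral_convergent hk) Filter.tendsto_id
  rw [← Real.Gamma_eq_integral hk, Real.Gamma_nat_eq_factorial] at h1
  have hf : (0:ℝ) < k.factorial := by positivity
  obtain ⟨T, hT, hT0⟩ := ((h1.eventually_const_lt (half_lt_self hf)).and
    (Filter.eventually_ge_atTop 0)).exists
  refine ⟨T, hT0, ?_⟩
  simp only [add_sub_cancel_right, Real.rpow_natCast, id] at hT
  simp_rw [← mul_div_assoc]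
  rw [intervalIntegral.integral_div, le_div_iff₀ hf]
  linarith

lemma countPerms_le {k : ℕ} (m : Sym ℕ k) :
    Multiset.countPerms (m : Multiset ℕ) ≤ k.factorial := by
  have h := Nat.multinomial_spec (m : Multiset ℕ).toFinset fun i => (m : Multiset ℕ).count i
  rw [Multiset.toFinset_sum_count_eq, Sym.card_coe] at h
  rw [← h, Multiset.countPerms, Finsupp.multinomial_eq]
  simp only [Multiset.toFinsupp_support]
  exact Nat.le_mul_of_pos_left _ (Finset.prod_pos fun i _ => Nat.factorial_pos _)

lemma pow_sum_div_factorial_le (S : Finset ℕ) (k : ℕ) (g : ℕ → ℝ) (hg : ∀ p ∈ S, 0 ≤ g p) :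
    (∑ p ∈ S, g p) ^ k / k.factorial ≤ ∑ m ∈ S.sym k, (m.1.map g).prod := by
  rw [Finset.sum_pow, div_le_iff₀ (by positivity), Finset.sum_mul]
  refine Finset.sum_le_sum fun m hm => ?_
  rw [mul_comm]
  refine mul_le_mul_of_nonneg_left ?_ ?_
  · exact_mod_cast countPerms_le m
  · refine Multiset.prod_nonneg fun a ha => ?_
    obtain ⟨p, hp, rfl⟩ := Multiset.mem_map.1 ha
    exact hg p (Finset.mem_sym_iff.1 hm p hp)

lemma prod_map_rpow (m : Multiset ℕ) (s : ℝ) :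
    (m.map fun p : ℕ => (p:ℝ) ^ s).prod = ((m.prod : ℕ) : ℝ) ^ s := by
  induction m using Multiset.induction with
  | empty => simp
  | cons a m ih => rw [Multiset.map_cons, Multiset.prod_cons, ih, Multiset.prod_cons, Nat.cast_mul,
      Real.mul_rpow (Nat.cast_nonneg _) (Nat.cast_nonneg _)]

lemma inv_one_sub_le {x : ℝ} (h1 : x ≤ 1 / 2) :
    (1 - x)⁻¹ ≤ Real.exp (x + 2 * x ^ 2) := by
  have h2 : (1 - x)⁻¹ ≤ 1 + x + 2 * x ^ 2 := by
    rw [inv_le_iff_one_le_mul₀ (by linarith)]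
    nlinarith [mul_nonneg (sq_nonneg x) (by linarith : 0 ≤ 1 - 2 * x)]
  linarith [Real.add_one_le_exp (x + 2 * x ^ 2)]

/-- The map `n ↦ n ^ (-s)` as a monoid-with-zero homomorphism. -/
noncomputable def rpowNegHom (s : ℝ) (hs : s ≠ 0) : ℕ →*₀ ℝ where
  toFun n := (n : ℝ) ^ (-s)
  map_zero' := by simp [Real.zero_rpow (neg_ne_zero.2 hs)]
  map_one' := by simp
  map_mul' m n := by
    simp [Real.mul_rpow (Nat.cast_nonneg m) (Nat.cast_nonneg n)]

lemma tendsto_prod_primesBelow {s : ℝ} (hs : 1 < s) :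
    Filter.Tendsto (fun N : ℕ => ∏ p ∈ N.primesBelow, (1 - (p : ℝ) ^ (-s))⁻¹) Filter.atTop
      (nhds (∑' n : ℕ, 1 / (n : ℝ) ^ s)) := by
  have h := EulerProduct.eulerProduct_completely_multiplicative
    (f := rpowNegHom s (by positivity)) (by
      refine (Real.summable_nat_rpow.2 (neg_lt_neg hs)).congr fun n => ?_
      simp only [rpowNegHom, MonoidWithZeroHom.coe_mk, ZeroHom.coe_mk]
      rw [Real.norm_of_nonneg (by positivity)])
  simpa [rpowNegHom, Real.rpow_neg] using h

lemma prod_primesBelow_le {s : ℝ} (hs : 1 ≤ s) (N : ℕ) :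
    ∏ p ∈ N.primesBelow, (1 - (p : ℝ) ^ (-s))⁻¹ ≤
      Real.exp (∑ p ∈ N.primesBelow, (p : ℝ) ^ (-s) + 2 * ∑' n : ℕ, 1 / (n : ℝ) ^ 2) := by
  have hx : ∀ p ∈ N.primesBelow, (p : ℝ) ^ (-s) ≤ 1 / p ∧ (1 : ℝ) / p ≤ 1 / 2 := by
    intro p hp
    have hp2 : (2 : ℝ) ≤ p := by exact_mod_cast (Nat.prime_of_mem_primesBelow hp).two_le
    refine ⟨?_, one_div_le_one_div_of_le two_pos hp2⟩
    rw [one_div, ← Real.rpow_neg_one]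
    exact Real.rpow_le_rpow_of_exponent_le (by linarith) (by linarith)
  calc _ ≤ ∏ p ∈ N.primesBelow, Real.exp ((p : ℝ) ^ (-s) + 2 * (1 / (p : ℝ) ^ 2)) := by
        refine Finset.prod_le_prod (fun p hp => ?_) fun p hp => ?_
        · have := hx p hp
          exact inv_nonneg.2 (by linarith)
        · refine (inv_one_sub_le ((hx p hp).1.trans (hx p hp).2)).trans ?_
          rw [← one_div_pow]
          gcongr
          exact (hx p hp).1
    _ ≤ _ := by
        rw [← Real.exp_sum, Finset.sum_add_distrib, ← Finset.mul_sum]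
        gcongr
        exact (Real.summable_one_div_nat_pow.2 one_lt_two).sum_le_tsum _
          fun _ _ => by positivity

lemma eventually_le_sum_primesBelow : ∃ C : ℝ, ∀ t : ℝ, 0 ≤ t → ∀ᶠ N : ℕ in Filter.atTop,
    t + 1 ≤ ∑ p ∈ N.primesBelow, (p : ℝ) ^ (-(1 + Real.exp (-C - t))) := by
  set K : ℝ := 2 * ∑' n : ℕ, 1 / (n : ℝ) ^ 2
  have h := tendsto_sub_mul_tsum_nat_rpow.eventually_const_lt (one_half_lt_one)
  obtain ⟨b, hb, hbI⟩ := (mem_nhdsGT_iff_exists_Ioo_subset).1 h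
  refine ⟨max (Real.log 2 + K + 1) (1 - Real.log (b - 1)), fun t ht => ?_⟩
  set C : ℝ := max (Real.log 2 + K + 1) (1 - Real.log (b - 1))
  have hC1 : Real.log 2 + K + 1 ≤ C := le_max_left _ _
  have hC2 : 1 - Real.log (b - 1) ≤ C := le_max_right _ _
  set u := Real.exp (-C - t) with hu
  have hu0 : 0 < u := Real.exp_pos _
  have hub : 1 + u < b := by
    have : u < b - 1 := by
      rw [← Real.exp_log (sub_pos.2 hb)]
      exact Real.exp_lt_exp.2 (by linarith)
    linarith
  have hz := hbI (⟨by linarith, hub⟩ : 1 + u ∈ Set.Ioo 1 b)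
  simp only [Set.mem_ofPred_eq, add_sub_cancel_left] at hz
  have hz' : 1 / 2 / u < ∑' n : ℕ, 1 / (n : ℝ) ^ (1 + u) := by
    rw [div_lt_iff₀ hu0]
    linarith
  filter_upwards [(tendsto_prod_primesBelow (by linarith : 1 < 1 + u)).eventually_const_lt hz']
    with N hN
  have h1 := hN.le.trans (prod_primesBelow_le (by linarith) N)
  rw [← Real.log_le_iff_le_exp (by positivity), Real.log_div (by norm_num) hu0.ne', hu,
    Real.log_exp, Real.log_div (by norm_num) (by norm_num), Real.log_one] at h1
  linarith

lemma exists_uniform_le_sum_primesBelow : ∃ C : ℝ, ∀ T : ℝ, ∃ N : ℕ, ∀ t ∈ Set.Icc 0 T,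
    t ≤ ∑ p ∈ N.primesBelow, (p : ℝ) ^ (-(1 + Real.exp (-C - t))) := by
  obtain ⟨C, hC⟩ := eventually_le_sum_primesBelow
  refine ⟨C, fun T => ?_⟩
  obtain ⟨N, hN⟩ := ((Filter.eventually_all_finset (Finset.range (⌊T⌋₊ + 1))).2
    fun j _ => hC j j.cast_nonneg).exists
  refine ⟨N, fun t ht => ?_⟩
  have hj := hN ⌊t⌋₊ (Finset.mem_range.2 (Nat.lt_succ_of_le (Nat.floor_mono ht.2)))
  refine (Nat.lt_floor_add_one t).le.trans (hj.trans (Finset.sum_le_sum fun p hp => ?_))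
  have hp1 : (1 : ℝ) ≤ p := by exact_mod_cast (Nat.prime_of_mem_primesBelow hp).one_le
  have := Nat.floor_le ht.1
  gcongr

lemma two_pow_card_le_prod {m : Multiset ℕ} (h : ∀ p ∈ m, p.Prime) : 2 ^ m.card ≤ m.prod :=
  Multiset.pow_card_le_prod fun p hp => (h p hp).two_le

lemma prime_of_mem_sym_primesBelow {N k : ℕ} {m : Sym ℕ k} (hm : m ∈ N.primesBelow.sym k) :
    ∀ p ∈ m.1, p.Prime :=
  fun p hp => Nat.prime_of_mem_primesBelow (Finset.mem_sym_iff.1 hm p hp)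

lemma two_pow_le_prod_of_mem_sym {N k : ℕ} {m : Sym ℕ k} (hm : m ∈ N.primesBelow.sym k) :
    2 ^ k ≤ m.1.prod := by
  simpa only [m.2] using two_pow_card_le_prod (prime_of_mem_sym_primesBelow hm)

lemma le_sum_sym_primesBelow {N k : ℕ} (hk : 0 < k) {C T : ℝ} (hT : 0 ≤ T)
    (hN : ∀ t ∈ Set.Icc 0 T,
      t ≤ ∑ p ∈ N.primesBelow, (p : ℝ) ^ (-(1 + Real.exp (-C - t)))) :
    Real.exp (-C) * ∫ t in (0:ℝ)..T, Real.exp (-t) * (t ^ k / k.factorial) ≤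
      ∑ m ∈ N.primesBelow.sym k, 1 / ((m.1.prod : ℕ) * Real.log (m.1.prod : ℕ)) := by
  have hprod : ∀ m ∈ N.primesBelow.sym k, 1 < m.1.prod := fun m hm =>
    (Nat.one_lt_two_pow hk.ne').trans_le (two_pow_le_prod_of_mem_sym hm)
  calc _ = ∫ t in (0:ℝ)..T, Real.exp (-C - t) * (t ^ k / k.factorial) := by
        rw [← intervalIntegral.integral_const_mul]
        congr 1
        ext t
        rw [sub_eq_add_neg, Real.exp_add]
        ring
    _ ≤ ∫ t in (0:ℝ)..T, ∑ m ∈ N.primesBelow.sym k, 1 / (m.1.prod : ℝ) *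
          (Real.exp (-C - t) * Real.exp (-(Real.log (m.1.prod : ℕ) * Real.exp (-C - t)))) := by
        refine intervalIntegral.integral_mono_on hT
          (Continuous.intervalIntegrable (by fun_prop) _ _)
          (Continuous.intervalIntegrable (by fun_prop) _ _) fun t ht => ?_
        have h1 : t ^ k / k.factorial ≤ _ := (div_le_div_of_nonneg_right
          (pow_le_pow_left₀ ht.1 (hN t ht) k) (by positivity)).trans
          (pow_sum_div_factorial_le _ k _ fun p _ => by positivity)
        refine (mul_le_mul_of_nonneg_left h1 (Real.exp_pos _).le).trans_eq ?_
        rw [Finset.mul_sum]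
        refine Finset.sum_congr rfl fun m hm => ?_
        have hm0 : (0 : ℝ) < (m.1.prod : ℕ) := by exact_mod_cast (zero_lt_one.trans (hprod m hm))
        rw [prod_map_rpow, neg_add, Real.rpow_add hm0, Real.rpow_neg_one,
          Real.rpow_def_of_pos hm0 (-Real.exp _), mul_neg]
        ring
    _ = ∑ m ∈ N.primesBelow.sym k, 1 / (m.1.prod : ℝ) * ∫ t in (0:ℝ)..T,
          (Real.exp (-C - t) * Real.exp (-(Real.log (m.1.prod : ℕ) * Real.exp (-C - t)))) := by
        rw [intervalIntegral.integral_finsetSum fun m _ =>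
          Continuous.intervalIntegrable (by fun_prop) _ _]
        simp_rw [intervalIntegral.integral_const_mul]
    _ ≤ _ := by
        refine Finset.sum_le_sum fun m hm => ?_
        rw [← one_div_mul_one_div]
        exact mul_le_mul_of_nonneg_left
          (integral_exp_mul_exp_le (Real.log_pos (by exact_mod_cast hprod m hm))) (by positivity)

theorem primitive_far_out_positive :
    ∃ c : ℝ, 0 < c ∧ ∀ x : ℝ, ∃ A : Set ℕ,
      IsPrimitive A ∧ (∀ a ∈ A, x ≤ (a : ℝ)) ∧ c ≤ f A := by
  obtain ⟨C, hC⟩ := exists_uniform_le_sum_primesBelow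
  refine ⟨Real.exp (-C) * (1 / 2), by positivity, fun x => ?_⟩
  obtain ⟨k, hk, hxk⟩ : ∃ k : ℕ, 0 < k ∧ x ≤ k :=
    ⟨⌈x⌉₊ + 1, Nat.succ_pos _, (Nat.le_ceil x).trans (by simp)⟩
  obtain ⟨T, hT0, hT⟩ := exists_half_le_integral_gamma k
  obtain ⟨N, hN⟩ := hC T
  have heq : ∀ m ∈ N.primesBelow.sym k, ∀ m' ∈ N.primesBelow.sym k,
      m.1.prod ∣ m'.1.prod → m = m' := fun m hm m' hm' hd =>
    Subtype.ext (multiset_eq_of_prod_dvd_prod (prime_of_mem_sym_primesBelow hm)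
      (prime_of_mem_sym_primesBelow hm') (by rw [m.2, m'.2]) hd)
  refine ⟨((N.primesBelow.sym k).image fun m => m.1.prod : Finset ℕ), ⟨?_, ?_⟩, ?_, ?_⟩
  · intro a ha
    obtain ⟨m, hm, rfl⟩ := Finset.mem_image.1 (Finset.mem_coe.1 ha)
    exact (Nat.one_lt_two_pow hk.ne').trans_le (two_pow_le_prod_of_mem_sym hm)
  · intro a ha b hb hab hd
    obtain ⟨m, hm, rfl⟩ := Finset.mem_image.1 (Finset.mem_coe.1 ha)
    obtain ⟨m', hm', rfl⟩ := Finset.mem_image.1 (Finset.mem_coe.1 hb)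
    exact hab (by rw [heq m hm m' hm' hd])
  · intro a ha
    obtain ⟨m, hm, rfl⟩ := Finset.mem_image.1 (Finset.mem_coe.1 ha)
    exact hxk.trans (by exact_mod_cast Nat.lt_two_pow_self.le.trans (two_pow_le_prod_of_mem_sym hm))
  · refine (mul_le_mul_of_nonneg_left hT (Real.exp_pos _).le).trans
      ((le_sum_sym_primesBelow hk hT0 hN).trans_eq ?_)
    rw [f, Finset.tsum_subtype' _ fun a : ℕ => 1 / ((a : ℝ) * Real.log a),
      Finset.sum_image fun m hm m' hm' h => heq m hm m' hm' h.dvd]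
end
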